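/- Let n ∈ ℕ and let U be a unitary 2^n × 2^n complex matrix. Then U belongs to the Clifford+T group on n qubits (no ancillas) if and only if all entries of U belong to 𝔻[ω] = ℤ[1/√2, i] and: det U = 1 if n ≥ 4; det U ∈ {−1, 1} if n = 3; det U ∈ {i, −1, −i, 1} if n = 2; and det U ∈ {1, ω, i, ω³, −1, ω⁵, −i, ω⁷} if n ≤ 1. -/

import Mathlib

noncomputable section

/-- The eighth root of unity `ω = e^{iπ/4} = (1+i)/√2`. -/
def ω : ℂ := (1 + Complex.I) / Real.sqrt 2

/-- A rational number is dyadic if it has the form `a / 2^n` with `a ∈ ℤ`, `n ∈ ℕ`. -/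
def IsDyadic (q : ℚ) : Prop := ∃ (a : ℤ) (n : ℕ), q = a / 2 ^ n

/-- Membership in the ring `𝔻[ω] = ℤ[1/√2, i]`: complex numbers of the form
`aω³ + bω² + cω + d` with `a, b, c, d` dyadic rationals. -/
def inDω (t : ℂ) : Prop :=
  ∃ a b c d : ℚ, IsDyadic a ∧ IsDyadic b ∧ IsDyadic c ∧ IsDyadic d ∧
    t = (a : ℂ) * ω ^ 3 + (b : ℂ) * ω ^ 2 + (c : ℂ) * ω + (d : ℂ)

/-- Membership in the ring `ℤ[ω]`: complex numbers of the form
`aω³ + bω² + cω + d` with `a, b, c, d ∈ ℤ`. -/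
def inZω (t : ℂ) : Prop :=
  ∃ a b c d : ℤ, t = (a : ℂ) * ω ^ 3 + (b : ℂ) * ω ^ 2 + (c : ℂ) * ω + (d : ℂ)

/-- The Hadamard gate. -/
def Hmat : Matrix (Fin 2) (Fin 2) ℂ := ((Real.sqrt 2 : ℂ))⁻¹ • !![1, 1; 1, -1]

/-- The phase gate `S`. -/
def Smat : Matrix (Fin 2) (Fin 2) ℂ := !![1, 0; 0, Complex.I]

/-- The `T` gate. -/
def Tmat : Matrix (Fin 2) (Fin 2) ℂ := !![1, 0; 0, ω]

/-- The `X` (not) gate. -/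
def Xmat : Matrix (Fin 2) (Fin 2) ℂ := !![0, 1; 1, 0]

/-- The controlled-not gate, as a matrix on two qubits: it sends `|a,b⟩` to `|a, a+b⟩`. -/
def CNOTmat : Matrix (Fin 2 × Fin 2) (Fin 2 × Fin 2) ℂ :=
  Matrix.of fun p q => if p.1 = q.1 ∧ p.2 = q.1 + q.2 then 1 else 0

/-- The operator obtained by applying the single-qubit gate `G` to the `j`-th of `n` qubits
(and the identity to the remaining factors); this is `P_σ⁻¹ (G ⊗ I) P_σ` written entrywise. -/
def app1 {n : ℕ} (G : Matrix (Fin 2) (Fin 2) ℂ) (j : Fin n) :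
    Matrix (Fin n → Fin 2) (Fin n → Fin 2) ℂ :=
  Matrix.of fun x y => if ∀ i, i ≠ j → x i = y i then G (x j) (y j) else 0

/-- The operator obtained by applying the two-qubit gate `G` to the ordered pair `(j, l)` of
distinct qubits among `n` qubits (and the identity to the remaining factors). -/
def app2 {n : ℕ} (G : Matrix (Fin 2 × Fin 2) (Fin 2 × Fin 2) ℂ) (j l : Fin n) :
    Matrix (Fin n → Fin 2) (Fin n → Fin 2) ℂ :=
  Matrix.of fun x y => if ∀ i, i ≠ j → i ≠ l → x i = y i then G (x j, x l) (y j, y l) else 0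

/-- The Clifford+T group on `n` qubits: the subgroup of the unitary group on `(ℂ²)^{⊗n}`
generated by the scalar `ω`, the gates `H`, `S`, `T` applied to any single qubit, and
CNOT applied to any ordered pair of distinct qubits. -/
def CliffordT (n : ℕ) : Subgroup (Matrix.unitaryGroup (Fin n → Fin 2) ℂ) :=
  Subgroup.closure
    {U | (U : Matrix (Fin n → Fin 2) (Fin n → Fin 2) ℂ)
            = ω • (1 : Matrix (Fin n → Fin 2) (Fin n → Fin 2) ℂ)
      ∨ (∃ j, (U : Matrix (Fin n → Fin 2) (Fin n → Fin 2) ℂ) = app1 Hmat j)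
      ∨ (∃ j, (U : Matrix (Fin n → Fin 2) (Fin n → Fin 2) ℂ) = app1 Smat j)
      ∨ (∃ j, (U : Matrix (Fin n → Fin 2) (Fin n → Fin 2) ℂ) = app1 Tmat j)
      ∨ (∃ j l, j ≠ l ∧ (U : Matrix (Fin n → Fin 2) (Fin n → Fin 2) ℂ) = app2 CNOTmat j l)}

/-- The Kronecker (tensor) product of a vector on `n` qubits with a vector on `m` qubits. -/
def tensorVec {n m : ℕ} (v : (Fin n → Fin 2) → ℂ) (w : (Fin m → Fin 2) → ℂ) :
    (Fin (n + m) → Fin 2) → ℂ :=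
  fun x => v (fun i => x (Fin.castAdd m i)) * w (fun i => x (Fin.natAdd n i))

/-- The first standard basis vector `e₀ = |0⋯0⟩` of `ℂ^(2^m)`. -/
def e0 (m : ℕ) : (Fin m → Fin 2) → ℂ := fun x => if x = fun _ => 0 then 1 else 0


/-! ### Arithmetic of `ω` -/

lemma sqrt2_sq : ((Real.sqrt 2 : ℝ) : ℂ) ^ 2 = 2 := by
  rw [← Complex.ofReal_pow, Real.sq_sqrt (by norm_num)]; norm_num

lemma sqrt2_ne : ((Real.sqrt 2 : ℝ) : ℂ) ≠ 0 := by
  intro h; have := sqrt2_sq; rw [h] at this; norm_num at this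

lemma om_sq : ω ^ 2 = Complex.I := by
  unfold ω
  rw [div_pow, sqrt2_sq, div_eq_iff (by norm_num)]
  linear_combination Complex.I_sq

lemma om_four : ω ^ 4 = -1 := by
  linear_combination (ω ^ 2 + Complex.I) * om_sq + Complex.I_sq

lemma om_eight : ω ^ 8 = 1 := by
  linear_combination (ω ^ 4 - 1) * om_four

lemma om_ne : ω ≠ 0 := by
  intro h; have := om_four; rw [h] at this; norm_num at this

lemma sqrt2_om : ((Real.sqrt 2 : ℝ) : ℂ) = ω - ω ^ 3 := by
  have h : ω * ((Real.sqrt 2 : ℝ) : ℂ) = 1 + Complex.I := by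
    unfold ω; field_simp [sqrt2_ne]
  have h2 := om_sq
  have h3 := om_four
  apply mul_left_cancel₀ om_ne
  linear_combination h - h2 + h3

lemma star_om : star ω = -ω ^ 3 := by
  have h : star ω = (1 - Complex.I) / Real.sqrt 2 := by
    unfold ω
    simp [Complex.conj_ofReal, sub_eq_add_neg]
  have h1 : ω * ((Real.sqrt 2 : ℝ) : ℂ) = 1 + Complex.I := by
    unfold ω; field_simp [sqrt2_ne]
  rw [h, div_eq_iff sqrt2_ne]
  linear_combination (ω^2) * h1 - (1 + Complex.I - 2) * om_sq - Complex.I_sq - 2 * om_sq + 2 * Complex.I_sq + 2 * om_sq + 2 * Complex.I * om_sq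

lemma star_om_mul : star ω * ω = 1 := by
  rw [star_om]; linear_combination -om_four

/-- The ring `ℤ[ω]`. -/
def RZ : Subring ℂ where
  carrier := {t | inZω t}
  zero_mem' := ⟨0, 0, 0, 0, by simp⟩
  one_mem' := ⟨0, 0, 0, 1, by simp⟩
  add_mem' := by
    rintro x y ⟨a, b, c, d, rfl⟩ ⟨a', b', c', d', rfl⟩
    exact ⟨a + a', b + b', c + c', d + d', by push_cast; ring⟩
  neg_mem' := by
    rintro x ⟨a, b, c, d, rfl⟩
    exact ⟨-a, -b, -c, -d, by push_cast; ring⟩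
  mul_mem' := by
    rintro x y ⟨a, b, c, d, rfl⟩ ⟨a', b', c', d', rfl⟩
    refine ⟨a * d' + b * c' + c * b' + d * a', b * d' + c * c' + d * b' - a * a',
      c * d' + d * c' - a * b' - b * a', d * d' - a * c' - b * b' - c * a', ?_⟩
    push_cast
    linear_combination (a * a' * ω ^ 2 + (a * b' + b * a') * ω + (a * c' + b * b' + c * a')) * om_four

lemma om_mem : ω ∈ RZ := ⟨0, 0, 1, 0, by simp⟩

lemma star_mem_RZ {t : ℂ} (h : t ∈ RZ) : star t ∈ RZ := by
  obtain ⟨a, b, c, d, rfl⟩ := h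
  refine ⟨-c, -b, -a, d, ?_⟩
  simp only [star_add, star_mul', star_pow, star_om]
  simp
  have h6 : ω ^ 6 = - ω ^ 2 := by linear_combination ω ^ 2 * om_four
  have h9 : ω ^ 9 = ω := by linear_combination ω * om_eight
  linear_combination b * h6 - a * h9

lemma sqrt2_mem : ((Real.sqrt 2 : ℝ) : ℂ) ∈ RZ := by
  rw [sqrt2_om]; exact RZ.sub_mem om_mem (RZ.pow_mem om_mem 3)

/-- The prime above `2`. -/
def δ : ℂ := ω - 1

lemma dl_mem : δ ∈ RZ := RZ.sub_mem om_mem RZ.one_mem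

lemma dl_sq : δ ^ 2 = ((Real.sqrt 2 : ℝ) : ℂ) * (ω * (1 - ((Real.sqrt 2 : ℝ) : ℂ))) := by
  have h := sqrt2_sq
  have h2 := sqrt2_om
  unfold δ
  linear_combination ω * h - ω * h2 + om_four

lemma sqrt2_dl : ((Real.sqrt 2 : ℝ) : ℂ) = δ ^ 2 * (ω ^ 3 * (1 + ((Real.sqrt 2 : ℝ) : ℂ))) := by
  rw [dl_sq]
  have h := sqrt2_sq
  have h2 := om_four
  linear_combination (Real.sqrt 2) * ω ^ 4 * h + (Real.sqrt 2) * h2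

lemma dl_ne : δ ≠ 0 := by
  intro h; have := sqrt2_dl; rw [h] at this; apply sqrt2_ne; rw [this]; simp

/-- divisibility by `δ` in `ℤ[ω]` -/
def Dv (w : ℂ) : Prop := ∃ s ∈ RZ, w = δ * s

lemma Dv.add {x y : ℂ} (hx : Dv x) (hy : Dv y) : Dv (x + y) := by
  obtain ⟨s, hs, rfl⟩ := hx; obtain ⟨t, ht, rfl⟩ := hy
  exact ⟨s + t, RZ.add_mem hs ht, by ring⟩

lemma Dv.mul {x y : ℂ} (hx : x ∈ RZ) (hy : Dv y) : Dv (x * y) := by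
  obtain ⟨s, hs, rfl⟩ := hy
  exact ⟨x * s, RZ.mul_mem hx hs, by ring⟩

lemma two_dl : ∃ s ∈ RZ, (2 : ℂ) = δ ^ 4 * s := by
  refine ⟨(ω ^ 3 * (1 + ((Real.sqrt 2 : ℝ) : ℂ))) ^ 2, ?_, ?_⟩
  · exact RZ.pow_mem (RZ.mul_mem (RZ.pow_mem om_mem 3) (RZ.add_mem RZ.one_mem sqrt2_mem)) 2
  · rw [← sqrt2_sq]; conv_lhs => rw [sqrt2_dl]
    ring

lemma dv_or {w : ℂ} (h : w ∈ RZ) : (∃ s ∈ RZ, w = δ * s) ∨ ∃ s ∈ RZ, w = 1 + δ * s := by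
  obtain ⟨a, b, c, d, rfl⟩ := h
  obtain ⟨t, ht, h2⟩ := two_dl
  have hz : ∀ m : ℤ, (m : ℂ) ∈ RZ := fun m => intCast_mem RZ m
  have key : ∀ q : ℤ, (q : ℂ) * δ ^ 3 * t + (a * (ω ^ 2 + ω + 1) + b * (ω + 1) + c) ∈ RZ := by
    intro q
    exact RZ.add_mem (RZ.mul_mem (RZ.mul_mem (hz _) (RZ.pow_mem dl_mem 3)) ht)
      (RZ.add_mem (RZ.add_mem (RZ.mul_mem (hz _) (RZ.add_mem (RZ.add_mem (RZ.pow_mem om_mem 2)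
        om_mem) RZ.one_mem)) (RZ.mul_mem (hz _) (RZ.add_mem om_mem RZ.one_mem))) (hz _))
  rcases Int.even_or_odd' (a + b + c + d) with ⟨q, hq | hq⟩
  · left
    refine ⟨_, key q, ?_⟩
    have hq' : (a : ℂ) + b + c + d = 2 * q := by exact_mod_cast hq
    have : ω = 1 + δ := by unfold δ; ring
    linear_combination hq' + q * h2 + (a * (ω ^ 2 + ω + 1) + b * (ω + 1) + c) * (this)
  · right
    refine ⟨_, key q, ?_⟩
    have hq' : (a : ℂ) + b + c + d = 2 * q + 1 := by exact_mod_cast hq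
    have : ω = 1 + δ := by unfold δ; ring
    linear_combination hq' + q * h2 + (a * (ω ^ 2 + ω + 1) + b * (ω + 1) + c) * (this)

/-- normal form mod `δ³` of the units mod `δ` -/
lemma dv_or_phase {w : ℂ} (h : w ∈ RZ) :
    Dv w ∨ ∃ m : ℕ, ∃ s ∈ RZ, ω ^ m * w = 1 + δ ^ 3 * s := by
  rcases dv_or h with h1 | ⟨s, hs, rfl⟩
  · exact Or.inl h1
  right
  have hom : ω = 1 + δ := by unfold δ; ring
  -- first normalise mod δ²
  have h1 : ∃ m : ℕ, ∃ s' ∈ RZ, ω ^ m * (1 + δ * s) = 1 + δ ^ 2 * s' := by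
    rcases dv_or hs with ⟨s', hs', rfl⟩ | ⟨s', hs', rfl⟩
    · exact ⟨0, s', hs', by ring⟩
    · refine ⟨7, ω ^ 7 * s', RZ.mul_mem (RZ.pow_mem om_mem 7) hs', ?_⟩
      have := om_eight
      linear_combination this - ω ^ 7 * hom
  obtain ⟨m, s', hs', e⟩ := h1
  rcases dv_or hs' with ⟨s', hs2, rfl⟩ | ⟨s', hs2, rfl⟩
  · exact ⟨m, s', hs2, by rw [e]; ring⟩
  · obtain ⟨t, ht, h2⟩ := two_dl
    refine ⟨m + 6, ω ^ 6 * (s' - δ ^ 2 * t), RZ.mul_mem (RZ.pow_mem om_mem 6)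
      (RZ.sub_mem hs2 (RZ.mul_mem (RZ.pow_mem dl_mem 2) ht)), ?_⟩
    have := om_eight
    have h3 : ω ^ 2 = 1 + δ ^ 4 * t * δ + δ ^ 2 := by rw [← h2, hom]; ring
    rw [pow_add, mul_right_comm, e]
    linear_combination om_eight - ω ^ 6 * h3

lemma normSq_form (a b c d : ℤ) :
    let w : ℂ := (a : ℂ) * ω ^ 3 + (b : ℂ) * ω ^ 2 + (c : ℂ) * ω + (d : ℂ)
    star w * w = (((a ^ 2 + b ^ 2 + c ^ 2 + d ^ 2 : ℤ) : ℝ) +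
      Real.sqrt 2 * ((a * b + b * c + c * d - a * d : ℤ) : ℝ) : ℝ) := by
  intro w
  have h : star w = -(a : ℂ) * ω - b * ω ^ 2 - c * ω ^ 3 + d := by
    have h6 : ω ^ 6 = - ω ^ 2 := by linear_combination ω ^ 2 * om_four
    have h9 : ω ^ 9 = ω := by linear_combination ω * om_eight
    simp only [w, star_add, star_mul', star_pow, star_om]
    simp
    linear_combination b * h6 - a * h9
  rw [h]
  push_cast
  rw [sqrt2_om]
  simp only [w]
  linear_combination (-(a:ℂ)^2 - b^2 - c^2 - (a * b + b * c) * ω - a * c * ω ^ 2 ) * om_four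

lemma rat_of_sqrt {A B q : ℤ} (h : (A : ℝ) + Real.sqrt 2 * (B : ℝ) = q) : A = q ∧ B = 0 := by
  have hB : B = 0 := by
    by_contra hB
    have hB' : (B : ℝ) ≠ 0 := by exact_mod_cast hB
    have : Real.sqrt 2 = (((q - A : ℤ) / B : ℚ) : ℝ) := by
      push_cast; rw [eq_div_iff hB']; linarith
    exact irrational_sqrt_two ⟨_, this.symm⟩
  subst hB
  refine ⟨?_, rfl⟩
  simp at h; exact_mod_cast h

lemma not_dv_one : ¬ Dv 1 := by
  rintro ⟨s, hs, h⟩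
  obtain ⟨t, ht, h2⟩ := two_dl
  -- 2 * (s^4) = t , so  |s|^8 * 4 = |t|^2
  have h4 : 2 * s ^ 4 = t := by
    have : (δ * s) ^ 4 = 1 := by rw [← h]; norm_num
    linear_combination s ^ 4 * h2 + t * this
  have ht' : t = (ω ^ 3 * (1 + ((Real.sqrt 2 : ℝ) : ℂ))) ^ 2 := by
    have e : (2 : ℂ) = δ ^ 4 * (ω ^ 3 * (1 + ((Real.sqrt 2 : ℝ) : ℂ))) ^ 2 := by
      rw [← sqrt2_sq]; conv_lhs => rw [sqrt2_dl]
      ring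
    exact mul_left_cancel₀ (pow_ne_zero 4 dl_ne) (h2.symm.trans e)
  -- (1/2) ∈ RZ
  have hinv : t * (ω ^ 2 * (1 - ((Real.sqrt 2 : ℝ) : ℂ)) ^ 2) = 1 := by
    rw [ht']
    have h := sqrt2_sq
    have : ((1 + ((Real.sqrt 2 : ℝ) : ℂ)) * (1 - ((Real.sqrt 2 : ℝ) : ℂ))) ^ 2 = 1 := by
      have : (1 + ((Real.sqrt 2 : ℝ) : ℂ)) * (1 - ((Real.sqrt 2 : ℝ) : ℂ)) = -1 := by
        linear_combination -h
      rw [this]; norm_num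
    linear_combination ω ^ 8 * this + om_eight
  have hu : ∃ u ∈ RZ, 2 * u = 1 := by
    refine ⟨s ^ 4 * (ω ^ 2 * (1 - ((Real.sqrt 2 : ℝ) : ℂ)) ^ 2), ?_, ?_⟩
    · exact RZ.mul_mem (RZ.pow_mem hs 4) (RZ.mul_mem (RZ.pow_mem om_mem 2)
        (RZ.pow_mem (RZ.sub_mem RZ.one_mem sqrt2_mem) 2))
    · rw [← mul_assoc, h4, hinv]
  obtain ⟨u, ⟨a, b, c, d, hu⟩, h2u⟩ := hu
  have hn := normSq_form a b c d
  simp only [← hu] at hn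
  have : star u * u * 4 = 1 := by
    have h5 : star u = u := by
      have : star (2 * u) = 1 := by rw [h2u]; simp
      simp only [star_mul'] at this
      have h2' : star (2 : ℂ) = 2 := by simp
      rw [h2'] at this
      linear_combination (this - h2u) / 2
    rw [h5]; linear_combination (2 * u + 1) * h2u
  rw [hn] at this
  have h6 : ((4 * (a ^ 2 + b ^ 2 + c ^ 2 + d ^ 2) : ℤ) : ℝ) +
      Real.sqrt 2 * ((4 * (a * b + b * c + c * d - a * d) : ℤ) : ℝ) = ((1 : ℤ) : ℝ) := by
    have : (((((a ^ 2 + b ^ 2 + c ^ 2 + d ^ 2 : ℤ) : ℝ) +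
      Real.sqrt 2 * ((a * b + b * c + c * d - a * d : ℤ) : ℝ)) * 4 : ℝ) : ℂ) = (1 : ℝ) := by
      rw [Complex.ofReal_mul]; exact_mod_cast this
    have := Complex.ofReal_injective this
    push_cast at this ⊢; linarith
  have := (rat_of_sqrt h6).1
  omega

/-! ### dyadics -/

lemma IsDyadic.add {p q : ℚ} (hp : IsDyadic p) (hq : IsDyadic q) : IsDyadic (p + q) := by
  obtain ⟨a, n, rfl⟩ := hp; obtain ⟨b, m, rfl⟩ := hq
  exact ⟨a * 2 ^ m + b * 2 ^ n, n + m, by push_cast; field_simp; ring⟩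

lemma IsDyadic.mul {p q : ℚ} (hp : IsDyadic p) (hq : IsDyadic q) : IsDyadic (p * q) := by
  obtain ⟨a, n, rfl⟩ := hp; obtain ⟨b, m, rfl⟩ := hq
  exact ⟨a * b, n + m, by push_cast; field_simp; ring⟩

lemma IsDyadic.neg {p : ℚ} (hp : IsDyadic p) : IsDyadic (-p) := by
  obtain ⟨a, n, rfl⟩ := hp
  exact ⟨-a, n, by push_cast; ring⟩

lemma IsDyadic.int (a : ℤ) : IsDyadic a := ⟨a, 0, by simp⟩

lemma IsDyadic.clear {p : ℚ} (hp : IsDyadic p) : ∃ n, ∀ m ≥ n, ∃ a : ℤ, (2 : ℚ) ^ m * p = a := by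
  obtain ⟨a, n, rfl⟩ := hp
  refine ⟨n, fun m hm => ⟨2 ^ (m - n) * a, ?_⟩⟩
  obtain ⟨k, rfl⟩ := Nat.exists_eq_add_of_le hm
  simp [pow_add]; field_simp

lemma inD_of_RZ {t : ℂ} (h : t ∈ RZ) : inDω t := by
  obtain ⟨a, b, c, d, rfl⟩ := h
  exact ⟨a, b, c, d, .int a, .int b, .int c, .int d, by simp⟩

lemma inD_iff {t : ℂ} : inDω t ↔ ∃ k : ℕ, 2 ^ k * t ∈ RZ := by
  constructor
  · rintro ⟨a, b, c, d, ha, hb, hc, hd, rfl⟩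
    obtain ⟨n1, h1⟩ := ha.clear
    obtain ⟨n2, h2⟩ := hb.clear
    obtain ⟨n3, h3⟩ := hc.clear
    obtain ⟨n4, h4⟩ := hd.clear
    set m := n1 + n2 + n3 + n4 with hm
    obtain ⟨a', e1⟩ := h1 m (by omega)
    obtain ⟨b', e2⟩ := h2 m (by omega)
    obtain ⟨c', e3⟩ := h3 m (by omega)
    obtain ⟨d', e4⟩ := h4 m (by omega)
    have f1 : (2 : ℂ) ^ m * a = a' := by exact_mod_cast congrArg (Rat.cast (K := ℂ)) e1
    have f2 : (2 : ℂ) ^ m * b = b' := by exact_mod_cast congrArg (Rat.cast (K := ℂ)) e2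
    have f3 : (2 : ℂ) ^ m * c = c' := by exact_mod_cast congrArg (Rat.cast (K := ℂ)) e3
    have f4 : (2 : ℂ) ^ m * d = d' := by exact_mod_cast congrArg (Rat.cast (K := ℂ)) e4
    refine ⟨m, a', b', c', d', ?_⟩
    rw [← f1, ← f2, ← f3, ← f4]; ring
  · rintro ⟨k, a, b, c, d, h⟩
    refine ⟨a / 2 ^ k, b / 2 ^ k, c / 2 ^ k, d / 2 ^ k, ⟨a, k, rfl⟩, ⟨b, k, rfl⟩, ⟨c, k, rfl⟩,
      ⟨d, k, rfl⟩, ?_⟩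
    have h2 : (2 : ℂ) ^ k ≠ 0 := pow_ne_zero _ two_ne_zero
    apply mul_left_cancel₀ h2
    rw [h]; push_cast; field_simp

/-- `𝔻[ω]` as a subring -/
def RD : Subring ℂ where
  carrier := {t | inDω t}
  zero_mem' := inD_of_RZ RZ.zero_mem
  one_mem' := inD_of_RZ RZ.one_mem
  add_mem' := by
    intro x y hx hy
    obtain ⟨k, hk⟩ := inD_iff.1 hx
    obtain ⟨l, hl⟩ := inD_iff.1 hy
    have h2 : (2 : ℂ) ∈ RZ := by simp
    refine inD_iff.2 ⟨k + l, ?_⟩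
    have := RZ.add_mem (RZ.mul_mem (RZ.pow_mem h2 l) hk) (RZ.mul_mem (RZ.pow_mem h2 k) hl)
    convert this using 1; ring
  neg_mem' := by
    intro x hx
    obtain ⟨k, hk⟩ := inD_iff.1 hx
    exact inD_iff.2 ⟨k, by rw [mul_neg]; exact RZ.neg_mem hk⟩
  mul_mem' := by
    intro x y hx hy
    obtain ⟨k, hk⟩ := inD_iff.1 hx
    obtain ⟨l, hl⟩ := inD_iff.1 hy
    refine inD_iff.2 ⟨k + l, ?_⟩
    have := RZ.mul_mem hk hl
    convert this using 1; ring

lemma RZ_le_RD {t : ℂ} (h : t ∈ RZ) : t ∈ RD := inD_of_RZ h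

lemma star_mem_RD {t : ℂ} (h : t ∈ RD) : star t ∈ RD := by
  obtain ⟨k, hk⟩ := inD_iff.1 h
  refine inD_iff.2 ⟨k, ?_⟩
  have := star_mem_RZ hk
  simpa using this

lemma half_mem : (2 : ℂ)⁻¹ ∈ RD :=
  inD_iff.2 ⟨1, by simp⟩

lemma sqrt2_inv_mem : ((Real.sqrt 2 : ℝ) : ℂ)⁻¹ ∈ RD := by
  have : ((Real.sqrt 2 : ℝ) : ℂ)⁻¹ = (2 : ℂ)⁻¹ * (Real.sqrt 2 : ℝ) := by
    have := sqrt2_ne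
    field_simp; exact sqrt2_sq.symm
  rw [this]; exact RD.mul_mem half_mem (RZ_le_RD sqrt2_mem)

lemma RD_clear {t : ℂ} (h : t ∈ RD) : ∃ k, ∀ m ≥ k, δ ^ m * t ∈ RZ := by
  obtain ⟨k, hk⟩ := inD_iff.1 h
  refine ⟨4 * k, fun m hm => ?_⟩
  obtain ⟨l, rfl⟩ := Nat.exists_eq_add_of_le hm
  have : δ ^ 4 = 2 * (ω * (1 - ((Real.sqrt 2 : ℝ) : ℂ))) ^ 2 := by
    rw [← sqrt2_sq, ← mul_pow, ← dl_sq]; ring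
  rw [pow_add, pow_mul, this, mul_pow]
  have := RZ.mul_mem (RZ.mul_mem (RZ.pow_mem (RZ.pow_mem (RZ.mul_mem om_mem (RZ.sub_mem RZ.one_mem sqrt2_mem)) 2) k) (RZ.pow_mem dl_mem l)) hk
  convert this using 1; ring


/-! ### Column reduction -/

open Matrix

/-- `1/√2` -/
def rr : ℂ := ((Real.sqrt 2 : ℝ) : ℂ)⁻¹

lemma rr_sq : rr * rr = 2⁻¹ := by
  unfold rr; rw [← mul_inv, ← sq, sqrt2_sq]

lemma star_rr : star rr = rr := by
  unfold rr; simp [Complex.conj_ofReal]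

section Column

set_option linter.unusedSectionVars false

variable {ι : Type} [Fintype ι] [DecidableEq ι]

/-- one-level phase -/
def ph (x : ι) (c : ℂ) : Matrix ι ι ℂ := Matrix.diagonal (Function.update (fun _ => 1) x c)

/-- two-level Hadamard -/
def hd (x y : ι) : Matrix ι ι ℂ := Matrix.of fun i j =>
  if i = x then (if j = x then rr else if j = y then rr else 0)
  else if i = y then (if j = x then rr else if j = y then -rr else 0)
  else if i = j then 1 else 0

lemma ph_mulVec (x : ι) (c : ℂ) (v : ι → ℂ) :
    ph x c *ᵥ v = Function.update v x (c * v x) := by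
  ext i
  simp only [ph, Matrix.mulVec_diagonal, Function.update_apply]
  split_ifs with h <;> simp [h]

lemma sum_two (x y : ι) (h : x ≠ y) (a b : ℂ) (v : ι → ℂ) :
    ∑ j, (if j = x then a else if j = y then b else 0) * v j = a * v x + b * v y := by
  have : ∀ j, (if j = x then a else if j = y then b else 0) * v j =
      (if j = x then a * v x else 0) + (if j = y then b * v y else 0) := by
    intro j
    by_cases h1 : j = x
    · subst h1; simp [h]
    · by_cases h2 : j = y
      · subst h2; simp [h1]
      · simp [h1, h2]
  simp [this, Finset.sum_add_distrib]

lemma hd_mulVec (x y : ι) (h : x ≠ y) (v : ι → ℂ) :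
    hd x y *ᵥ v = Function.update (Function.update v x (rr * (v x + v y))) y
      (rr * (v x - v y)) := by
  ext i
  simp only [hd, Matrix.mulVec, dotProduct, Matrix.of_apply, Function.update_apply]
  by_cases h1 : i = x
  · subst h1
    simp only [if_true, if_neg h]
    rw [sum_two _ _ h]; ring
  · by_cases h2 : i = y
    · subst h2
      simp only [if_true, if_neg h1]
      rw [sum_two _ _ h]; ring
    · simp [h1, h2]

/-- The hypotheses on the monoid of available operators. -/
structure Good (Γ : Submonoid (Matrix ι ι ℂ)) : Prop where
  unit : ∀ g ∈ Γ, g ∈ Matrix.unitaryGroup ι ℂ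
  ent : ∀ g ∈ Γ, ∀ i j, g i j ∈ RD
  ph_mem : ∀ x, ph x ω ∈ Γ
  hd_mem : ∀ x y, x ≠ y → hd x y ∈ Γ

/-- `g` acts only on the coordinates in `S` -/
def Fx (g : Matrix ι ι ℂ) (S : Finset ι) : Prop :=
  ∀ v : ι → ℂ, (∀ x ∉ S, (g *ᵥ v) x = v x) ∧ ((∀ x ∈ S, v x = 0) → g *ᵥ v = v)

/-- reachability of vectors -/
def Reach (Γ : Submonoid (Matrix ι ι ℂ)) (S : Finset ι) (v w : ι → ℂ) : Prop :=
  ∃ g ∈ Γ, Fx g S ∧ g *ᵥ v = w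

variable {Γ : Submonoid (Matrix ι ι ℂ)} {S : Finset ι}

lemma Reach.refl (v : ι → ℂ) : Reach Γ S v v :=
  ⟨1, Γ.one_mem, fun v => ⟨by simp, by simp⟩, by simp⟩

lemma Reach.trans {u v w : ι → ℂ} (h1 : Reach Γ S u v) (h2 : Reach Γ S v w) :
    Reach Γ S u w := by
  obtain ⟨g, hg, fg, rfl⟩ := h1
  obtain ⟨k, hk, fk, rfl⟩ := h2
  refine ⟨k * g, Γ.mul_mem hk hg, fun v => ⟨fun x hx => ?_, fun hv => ?_⟩, ?_⟩
  · rw [← Matrix.mulVec_mulVec, (fk _).1 x hx, (fg _).1 x hx]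
  · rw [← Matrix.mulVec_mulVec, (fg _).2 hv, (fk _).2 hv]
  · rw [Matrix.mulVec_mulVec]

lemma Reach.smul {v w : ι → ℂ} (c : ℂ) (h : Reach Γ S v w) : Reach Γ S (c • v) (c • w) := by
  obtain ⟨g, hg, fg, rfl⟩ := h
  exact ⟨g, hg, fg, by rw [Matrix.mulVec_smul]⟩

lemma Reach.supp {v w : ι → ℂ} (h : Reach Γ S v w) (hv : ∀ x ∉ S, v x = 0) :
    ∀ x ∉ S, w x = 0 := by
  obtain ⟨g, hg, fg, rfl⟩ := h
  intro x hx
  rw [(fg v).1 x hx, hv x hx]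

/-- squared norm -/
def nv (v : ι → ℂ) : ℂ := ∑ i, star (v i) * v i

lemma nv_unitary {g : Matrix ι ι ℂ} (hg : g ∈ Matrix.unitaryGroup ι ℂ) (v : ι → ℂ) :
    nv (g *ᵥ v) = nv v := by
  have e : ∀ v : ι → ℂ, nv v = star v ⬝ᵥ v := fun v => rfl
  rw [e, e, Matrix.star_mulVec, Matrix.dotProduct_mulVec, Matrix.vecMul_vecMul,
    ← Matrix.dotProduct_mulVec]
  have : gᴴ * g = 1 := Matrix.mem_unitaryGroup_iff'.1 hg
  rw [this, Matrix.one_mulVec]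

lemma nv_smul (c : ℂ) (v : ι → ℂ) : nv (c • v) = star c * c * nv v := by
  unfold nv
  rw [Finset.mul_sum]
  refine Finset.sum_congr rfl fun i _ => ?_
  simp only [Pi.smul_apply, smul_eq_mul, star_mul']
  ring

lemma Reach.nv_eq (hΓ : Good Γ) {v w : ι → ℂ} (h : Reach Γ S v w) : nv w = nv v := by
  obtain ⟨g, hg, fg, rfl⟩ := h
  exact nv_unitary (hΓ.unit g hg) v

lemma reach_ph (hΓ : Good Γ) {x : ι} (hx : x ∈ S) (m : ℕ) (v : ι → ℂ) :
    Reach Γ S v (Function.update v x (ω ^ m * v x)) := by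
  induction m with
  | zero => simpa using Reach.refl v
  | succ m ih =>
    refine ih.trans ⟨ph x ω, hΓ.ph_mem x, fun v => ⟨fun z hz => ?_, fun hv => ?_⟩, ?_⟩
    · rw [ph_mulVec, Function.update_of_ne (by rintro rfl; exact hz hx)]
    · rw [ph_mulVec, hv x hx]; ext i
      by_cases h : i = x
      · subst h; simp [hv i hx]
      · simp [h]
    · rw [ph_mulVec]; simp; congr 1; ring

lemma reach_hd (hΓ : Good Γ) {x y : ι} (hx : x ∈ S) (hy : y ∈ S) (h : x ≠ y) (v : ι → ℂ) :
    Reach Γ S v (Function.update (Function.update v x (rr * (v x + v y))) y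
      (rr * (v x - v y))) := by
  refine ⟨hd x y, hΓ.hd_mem x y h, fun v => ⟨fun z hz => ?_, fun hv => ?_⟩, hd_mulVec x y h v⟩
  · rw [hd_mulVec x y h, Function.update_of_ne (by rintro rfl; exact hz hy),
      Function.update_of_ne (by rintro rfl; exact hz hx)]
  · rw [hd_mulVec x y h, hv x hx, hv y hy]; ext i
    simp only [Function.update_apply]
    split_ifs with h1 h2
    · subst h1; simp [hv i hy]
    · subst h2; simp [hv i hx]
    · rfl

lemma reach_swap (hΓ : Good Γ) {x y : ι} (hx : x ∈ S) (hy : y ∈ S) (h : x ≠ y) (v : ι → ℂ) :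
    Reach Γ S v (Function.update (Function.update v x (v y)) y (v x)) := by
  have h1 := reach_hd hΓ hx hy h v
  have h2 := h1.trans (reach_ph hΓ hy 4 _)
  have h3 := h2.trans (reach_hd hΓ hx hy h _)
  convert h3 using 1
  have := rr_sq
  ext i
  by_cases h1 : i = y
  · subst h1
    simp only [Function.update_self, Function.update_of_ne h, om_four]
    linear_combination -2 * v x * this
  · by_cases h2 : i = x
    · subst h2
      simp only [Function.update_self, Function.update_of_ne h, om_four]
      linear_combination -2 * v y * this
    · simp [h1, h2]

lemma exists_other {w : ι → ℂ} {k : ℕ} (hw : ∀ x, w x ∈ RZ)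
    (hn : nv w = (star δ * δ) ^ (k + 1)) {x : ι} (hx : ¬ Dv (w x)) :
    ∃ y, x ≠ y ∧ ¬ Dv (w y) := by
  by_contra hcon
  push Not at hcon
  have hs : ∀ T : Finset ι, x ∉ T → Dv (∑ i ∈ T, star (w i) * w i) := by
    intro T
    induction T using Finset.induction_on with
    | empty => intro _; exact ⟨0, RZ.zero_mem, by simp⟩
    | insert a T ha ih =>
      intro hxT
      rw [Finset.sum_insert ha]
      simp only [Finset.mem_insert, not_or] at hxT
      exact (Dv.mul (star_mem_RZ (hw a)) (hcon a hxT.1)).add (ih hxT.2)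
  have h1 := hs (Finset.univ.erase x) (by simp)
  have h2 : nv w = star (w x) * w x + ∑ i ∈ Finset.univ.erase x, star (w i) * w i := by
    unfold nv; exact (Finset.add_sum_erase _ (fun i => star (w i) * w i) (Finset.mem_univ x)).symm
  obtain ⟨t, ht, e⟩ := (dv_or (hw x)).resolve_left hx
  obtain ⟨q, hq, e2⟩ := h1
  have hsd : star δ = -ω ^ 3 - 1 := by
    unfold δ; rw [star_sub, star_om, star_one]
  have hsd2 : star δ = δ * ω ^ 3 := by
    rw [hsd]; unfold δ; linear_combination -om_four
  apply not_dv_one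
  have hst : star (w x) = 1 + δ * (ω ^ 3 * star t) := by
    rw [e, star_add, star_mul', hsd2]; simp; ring
  have hT := star_mem_RZ ht
  refine ⟨star δ * (star δ * δ) ^ k - q - ω ^ 3 * star t - t - δ * ω ^ 3 * star t * t, ?_, ?_⟩
  · have hD := star_mem_RZ dl_mem
    have h3 := RZ.pow_mem om_mem 3
    exact RZ.sub_mem (RZ.sub_mem (RZ.sub_mem (RZ.sub_mem (RZ.mul_mem hD
      (RZ.pow_mem (RZ.mul_mem hD dl_mem) k)) hq) (RZ.mul_mem h3 hT)) ht)
      (RZ.mul_mem (RZ.mul_mem (RZ.mul_mem dl_mem h3) hT) ht)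
  · rw [h2, e2, hst] at hn
    rw [pow_succ] at hn
    rw [e] at hn
    linear_combination hn

lemma rr_dl {s : ℂ} (hs : s ∈ RZ) : Dv (rr * (δ ^ 3 * s)) := by
  refine ⟨ω * (1 - ((Real.sqrt 2 : ℝ) : ℂ)) * s, RZ.mul_mem (RZ.mul_mem om_mem
    (RZ.sub_mem RZ.one_mem sqrt2_mem)) hs, ?_⟩
  have : δ ^ 3 = δ ^ 2 * δ := by ring
  rw [this, dl_sq]; unfold rr
  have := sqrt2_ne
  field_simp

lemma Dv.mem {w : ℂ} (h : Dv w) : w ∈ RZ := by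
  obtain ⟨s, hs, rfl⟩ := h; exact RZ.mul_mem dl_mem hs

lemma step (hΓ : Good Γ) (k : ℕ) : ∀ (N : ℕ) (w : ι → ℂ), (∀ x, w x ∈ RZ) →
    (∀ x ∉ S, w x = 0) → nv w = (star δ * δ) ^ (k + 1) →
    (Set.ncard {x | ¬ Dv (w x)} ≤ N) →
    ∃ w' : ι → ℂ, (∀ x, w' x ∈ RZ) ∧ Reach Γ S w (δ • w') := by
  intro N
  induction N with
  | zero =>
    intro w hw hS hn hc
    have h0 : {x | ¬ Dv (w x)} = ∅ := (Set.ncard_eq_zero (Set.toFinite _)).1 (by omega)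
    have hall : ∀ x, Dv (w x) := by
      intro x; by_contra h
      have : x ∈ {x | ¬ Dv (w x)} := h
      rw [h0] at this; exact this
    choose w' hw' e using hall
    refine ⟨w', hw', ?_⟩
    have : w = δ • w' := by ext i; simp [e]
    rw [← this]; exact Reach.refl w
  | succ N ih =>
    intro w hw hS hn hc
    by_cases hall : ∀ x, Dv (w x)
    · choose w' hw' e using hall
      refine ⟨w', hw', ?_⟩
      have : w = δ • w' := by ext i; simp [e]
      rw [← this]; exact Reach.refl w
    push Not at hall
    obtain ⟨x, hx⟩ := hall
    obtain ⟨y, hxy, hy⟩ := exists_other hw hn hx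
    have hz : Dv 0 := ⟨0, RZ.zero_mem, by simp⟩
    have hxS : x ∈ S := by
      by_contra h; exact hx (by rw [hS x h]; exact hz)
    have hyS : y ∈ S := by
      by_contra h; exact hy (by rw [hS y h]; exact hz)
    obtain ⟨m, s, hs, es⟩ := (dv_or_phase (hw x)).resolve_left hx
    obtain ⟨l, t, ht, et⟩ := (dv_or_phase (hw y)).resolve_left hy
    have r1 := reach_ph hΓ hxS m w
    have r2 := r1.trans (reach_ph hΓ hyS l _)
    have r3 := r2.trans (reach_hd hΓ hxS hyS hxy _)
    rw [Function.update_of_ne hxy.symm, et, es] at r3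
    simp only [Function.update_self, Function.update_of_ne hxy] at r3
    obtain ⟨q, hq, e2⟩ := two_dl
    have d1 : Dv (rr * (1 + δ ^ 3 * s + (1 + δ ^ 3 * t))) := by
      have : 1 + δ ^ 3 * s + (1 + δ ^ 3 * t) = δ ^ 3 * (s + t + δ * q) := by
        linear_combination e2
      rw [this]
      exact rr_dl (RZ.add_mem (RZ.add_mem hs ht) (RZ.mul_mem dl_mem hq))
    have d2 : Dv (rr * (1 + δ ^ 3 * s - (1 + δ ^ 3 * t))) := by
      have : 1 + δ ^ 3 * s - (1 + δ ^ 3 * t) = δ ^ 3 * (s - t) := by ring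
      rw [this]
      exact rr_dl (RZ.sub_mem hs ht)
    generalize hA : rr * (1 + δ ^ 3 * s + (1 + δ ^ 3 * t)) = A at *
    generalize hB : rr * (1 + δ ^ 3 * s - (1 + δ ^ 3 * t)) = B at *
    set u := Function.update (Function.update (Function.update (Function.update w x
      (1 + δ ^ 3 * s)) y (1 + δ ^ 3 * t)) x A) y B with hu
    have ux : u x = A := by simp [hu, hxy]
    have uy : u y = B := by simp [hu]
    have uz : ∀ z, z ≠ x → z ≠ y → u z = w z := by
      intro z h1 h2; simp [hu, h1, h2]
    have hmem : ∀ z, u z ∈ RZ := by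
      intro z
      by_cases h1 : z = x
      · subst h1; rw [ux]; exact d1.mem
      by_cases h2 : z = y
      · subst h2; rw [uy]; exact d2.mem
      rw [uz z h1 h2]; exact hw z
    obtain ⟨w', hw', r4⟩ := ih u hmem (r3.supp hS) (by rw [r3.nv_eq hΓ, hn]) (by
      have : {z | ¬ Dv (u z)} ⊂ {z | ¬ Dv (w z)} := by
        refine ⟨fun z hz => ?_, fun hcon => ?_⟩
        · simp only [Set.mem_ofPred_eq] at hz ⊢
          by_cases h1 : z = x
          · subst h1; exact hx
          by_cases h2 : z = y
          · subst h2; exact hy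
          rwa [uz z h1 h2] at hz
        · have := hcon (show x ∈ {z | ¬ Dv (w z)} from hx)
          apply this; rw [ux]; exact d1
      have := Set.ncard_lt_ncard this (Set.toFinite _)
      omega)
    exact ⟨w', hw', r3.trans r4⟩

lemma unit_quad (a b c d : ℤ) (h : a ^ 2 + b ^ 2 + c ^ 2 + d ^ 2 = 1) :
    ∃ m : ℕ, (a : ℂ) * ω ^ 3 + (b : ℂ) * ω ^ 2 + (c : ℂ) * ω + (d : ℂ) = ω ^ m := by
  have ha : a ^ 2 ≤ 1 := by nlinarith [sq_nonneg b, sq_nonneg c, sq_nonneg d]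
  have hb : b ^ 2 ≤ 1 := by nlinarith [sq_nonneg a, sq_nonneg c, sq_nonneg d]
  have hc : c ^ 2 ≤ 1 := by nlinarith [sq_nonneg b, sq_nonneg a, sq_nonneg d]
  have hd : d ^ 2 ≤ 1 := by nlinarith [sq_nonneg b, sq_nonneg c, sq_nonneg a]
  have key : ∀ z : ℤ, z ^ 2 ≤ 1 → z = 0 ∨ z = 1 ∨ z = -1 := by
    intro z hz
    have : -1 ≤ z := by nlinarith
    have : z ≤ 1 := by nlinarith
    omega
  have h4 := om_four
  rcases key a ha with rfl | rfl | rfl <;> rcases key b hb with rfl | rfl | rfl <;>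
  rcases key c hc with rfl | rfl | rfl <;> rcases key d hd with rfl | rfl | rfl <;>
  first
  | (exfalso; revert h; norm_num; done)
  | exact ⟨0, by push_cast; ring1⟩
  | exact ⟨1, by push_cast; ring1⟩
  | exact ⟨2, by push_cast; ring1⟩
  | exact ⟨3, by push_cast; ring1⟩
  | exact ⟨4, by push_cast; linear_combination -h4⟩
  | exact ⟨5, by push_cast; linear_combination -ω * h4⟩
  | exact ⟨6, by push_cast; linear_combination -ω ^ 2 * h4⟩
  | exact ⟨7, by push_cast; linear_combination -ω ^ 3 * h4⟩

lemma base {w : ι → ℂ} (hw : ∀ x, w x ∈ RZ) (hn : nv w = 1) :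
    ∃ x, ∃ m : ℕ, w = Pi.single x (ω ^ m) := by
  have hw' : ∀ x, ∃ a b c d : ℤ,
    w x = (a : ℂ) * ω ^ 3 + (b : ℂ) * ω ^ 2 + (c : ℂ) * ω + (d : ℂ) := hw
  choose a b c d e using hw'
  have h1 : ∀ x, star (w x) * w x = (((a x ^ 2 + b x ^ 2 + c x ^ 2 + d x ^ 2 : ℤ) : ℝ) +
      Real.sqrt 2 * ((a x * b x + b x * c x + c x * d x - a x * d x : ℤ) : ℝ) : ℝ) := by
    intro x; rw [e x]; exact normSq_form (a x) (b x) (c x) (d x)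
  have h2 : ((∑ x, (a x ^ 2 + b x ^ 2 + c x ^ 2 + d x ^ 2) : ℤ) : ℝ) +
      Real.sqrt 2 * ((∑ x, (a x * b x + b x * c x + c x * d x - a x * d x) : ℤ) : ℝ) =
      ((1 : ℤ) : ℝ) := by
    apply Complex.ofReal_injective
    unfold nv at hn
    simp only [h1] at hn
    rw [← Complex.ofReal_sum, Finset.sum_add_distrib, ← Finset.mul_sum] at hn
    rw [Int.cast_sum, Int.cast_sum]
    rw [hn]; simp
  have h3 := (rat_of_sqrt h2).1
  have hpos : ∀ x, 0 ≤ a x ^ 2 + b x ^ 2 + c x ^ 2 + d x ^ 2 := fun x => by positivity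
  obtain ⟨x, -, hx⟩ : ∃ x ∈ Finset.univ, a x ^ 2 + b x ^ 2 + c x ^ 2 + d x ^ 2 ≠ 0 := by
    apply Finset.exists_ne_zero_of_sum_ne_zero
    rw [h3]; norm_num
  rw [← Finset.add_sum_erase _ _ (Finset.mem_univ x)] at h3
  have hpos2 : 0 ≤ ∑ z ∈ Finset.univ.erase x, (a z ^ 2 + b z ^ 2 + c z ^ 2 + d z ^ 2) :=
    Finset.sum_nonneg fun z _ => hpos z
  have hx1 : a x ^ 2 + b x ^ 2 + c x ^ 2 + d x ^ 2 = 1 := by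
    have := hpos x; omega
  have hx2 : ∑ z ∈ Finset.univ.erase x, (a z ^ 2 + b z ^ 2 + c z ^ 2 + d z ^ 2) = 0 := by omega
  rw [Finset.sum_eq_zero_iff_of_nonneg fun z _ => hpos z] at hx2
  obtain ⟨m, hm⟩ := unit_quad _ _ _ _ hx1
  refine ⟨x, m, ?_⟩
  ext z
  by_cases hz : z = x
  · subst hz; rw [e z, hm]; simp
  · have := hx2 z (by simp [hz])
    have ha : a z = 0 := by
      by_contra h; have := sq_pos_of_ne_zero h; nlinarith [sq_nonneg (b z), sq_nonneg (c z), sq_nonneg (d z)]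
    have hb : b z = 0 := by
      by_contra h; have := sq_pos_of_ne_zero h; nlinarith [sq_nonneg (a z), sq_nonneg (c z), sq_nonneg (d z)]
    have hc : c z = 0 := by
      by_contra h; have := sq_pos_of_ne_zero h; nlinarith [sq_nonneg (b z), sq_nonneg (a z), sq_nonneg (d z)]
    have hd : d z = 0 := by
      by_contra h; have := sq_pos_of_ne_zero h; nlinarith [sq_nonneg (b z), sq_nonneg (c z), sq_nonneg (a z)]
    rw [e z, ha, hb, hc, hd]; simp [hz]

lemma reach_single (hΓ : Good Γ) {x y : ι} (hx : x ∈ S) (hy : y ∈ S) (m : ℕ) :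
    Reach Γ S (Pi.single x (ω ^ m)) (Pi.single y 1) := by
  have h8 : ω ^ (7 * m) * ω ^ m = 1 := by
    rw [← pow_add, show 7 * m + m = 8 * m by ring, pow_mul, om_eight, one_pow]
  have h1 : Reach Γ S (Pi.single x (ω ^ m)) (Pi.single x 1) := by
    have := reach_ph hΓ hx (7 * m) (Pi.single x (ω ^ m))
    convert this using 1
    ext i
    by_cases hi : i = x
    · subst hi; simp [h8]
    · simp [hi]
  by_cases hxy : x = y
  · subst hxy; exact h1
  refine h1.trans ?_
  convert reach_swap hΓ hx hy hxy _ using 1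
  ext i
  by_cases hi : i = y
  · subst hi; simp
  · by_cases h2 : i = x
    · subst h2; simp [hi, Ne.symm hi]
    · simp [hi, h2]

lemma column_aux (hΓ : Good Γ) {y : ι} (hy : y ∈ S) (k : ℕ) : ∀ (w : ι → ℂ), (∀ x, w x ∈ RZ) →
    (∀ x ∉ S, w x = 0) → nv w = (star δ * δ) ^ k →
    Reach Γ S w (δ ^ k • Pi.single y 1) := by
  induction k with
  | zero =>
    intro w hw hS hn
    obtain ⟨x, m, rfl⟩ := base hw (by simpa using hn)
    have hx : x ∈ S := by
      by_contra h
      have := hS x h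
      simp [om_ne] at this
    simpa using reach_single hΓ hx hy m
  | succ k ih =>
    intro w hw hS hn
    obtain ⟨w', hw', r⟩ := step hΓ k _ w hw hS hn le_rfl
    have hsd : star δ * δ ≠ 0 := mul_ne_zero (by simpa using dl_ne) dl_ne
    have h1 : nv w' = (star δ * δ) ^ k := by
      have := r.nv_eq hΓ
      rw [nv_smul, hn, pow_succ'] at this
      exact mul_left_cancel₀ hsd this
    have h2 : ∀ x ∉ S, w' x = 0 := by
      intro x hx
      have := r.supp hS x hx
      simpa [dl_ne] using this
    have := r.trans ((ih w' hw' h2 h1).smul δ)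
    rwa [smul_smul, ← pow_succ'] at this

lemma column (hΓ : Good Γ) {y : ι} (hy : y ∈ S) {v : ι → ℂ} (hv : ∀ x, v x ∈ RD)
    (hS : ∀ x ∉ S, v x = 0) (hn : nv v = 1) : Reach Γ S v (Pi.single y 1) := by
  choose k hk using fun x => RD_clear (hv x)
  have h := column_aux hΓ hy (∑ x, k x) (δ ^ (∑ x, k x) • v)
    (fun x => hk x _ (Finset.single_le_sum (f := k) (fun _ _ => Nat.zero_le _) (Finset.mem_univ x)))
    (fun x hx => by simp [hS x hx])
    (by rw [nv_smul, hn, mul_one, star_pow, mul_pow])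
  have := h.smul (δ ^ (∑ x, k x))⁻¹
  have hd := pow_ne_zero (∑ x, k x) dl_ne
  rwa [smul_smul, smul_smul, inv_mul_cancel₀ hd, one_smul, one_smul] at this

lemma reduce_aux (hΓ : Good Γ) (S : Finset ι) : ∀ U : Matrix ι ι ℂ, U ∈ Matrix.unitaryGroup ι ℂ →
    (∀ i j, U i j ∈ RD) → (∀ x ∉ S, U *ᵥ Pi.single x 1 = Pi.single x 1) →
    ∃ g ∈ Γ, g * U = 1 := by
  induction S using Finset.induction_on with
  | empty =>
    intro U hU hD hf
    refine ⟨1, Γ.one_mem, ?_⟩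
    rw [one_mul]
    ext i j
    have := congrFun (hf j (by simp)) i
    rw [Matrix.mulVec_single_one] at this
    simp only [Matrix.col_apply] at this
    rw [this, Matrix.one_apply, Pi.single_apply]
  | insert y S hyS ih =>
    intro U hU hD hf
    have hUU : Uᴴ * U = 1 := Matrix.mem_unitaryGroup_iff'.1 hU
    have hcol : ∀ x, U *ᵥ Pi.single x 1 = fun i => U i x := by
      intro x; rw [Matrix.mulVec_single_one]; rfl
    obtain ⟨g, hg, fg, e⟩ := column (S := insert y S) hΓ (Finset.mem_insert_self y S)
      (v := U *ᵥ Pi.single y 1) (by intro x; rw [hcol]; exact hD x y)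
      (by
        intro x hx
        have hxy : x ≠ y := by rintro rfl; simp at hx
        have h1 := congrFun (congrFun hUU x) y
        rw [Matrix.mul_apply, Matrix.one_apply_ne hxy] at h1
        have h2 := hf x hx
        rw [hcol] at h2
        have h3 : ∀ i, Uᴴ x i = if i = x then 1 else 0 := by
          intro i
          rw [Matrix.conjTranspose_apply]
          have := congrFun h2 i
          simp only [Pi.single_apply] at this
          rw [this]; split_ifs <;> simp
        simp only [h3] at h1
        rw [hcol]
        simpa using h1)
      (by
        rw [nv_unitary hU]
        unfold nv
        rw [Finset.sum_eq_single y]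
        · simp
        · intro b _ hb; simp [hb]
        · simp)
    have hgU : g * U ∈ Matrix.unitaryGroup ι ℂ := mul_mem (hΓ.unit g hg) hU
    obtain ⟨g', hg', e'⟩ := ih (g * U) hgU
      (by
        intro i j; rw [Matrix.mul_apply]
        exact RD.sum_mem fun l _ => RD.mul_mem (hΓ.ent g hg i l) (hD l j))
      (by
        intro x hx
        rw [← Matrix.mulVec_mulVec]
        by_cases hxy : x = y
        · subst hxy; exact e
        · have hx' : x ∉ insert y S := by simp [hxy, hx]
          rw [hf x hx']
          apply (fg _).2
          intro z hz
          have : z ≠ x := by rintro rfl; exact hx' hz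
          simp [this])
    exact ⟨g' * g, Γ.mul_mem hg' hg, by rw [mul_assoc, e']⟩

theorem synth (hΓ : Good Γ) {U : Matrix ι ι ℂ} (hU : U ∈ Matrix.unitaryGroup ι ℂ)
    (hD : ∀ i j, U i j ∈ RD) : U ∈ Γ := by
  have hU' : Uᴴ ∈ Matrix.unitaryGroup ι ℂ := Unitary.star_mem hU
  obtain ⟨g, hg, e⟩ := reduce_aux hΓ Finset.univ Uᴴ hU'
    (fun i j => by rw [Matrix.conjTranspose_apply]; exact star_mem_RD (hD j i)) (by simp)
  have hUU : Uᴴ * U = 1 := Matrix.mem_unitaryGroup_iff'.1 hU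
  have : g = U := by
    calc g = g * (Uᴴ * U) := by rw [hUU, mul_one]
      _ = U := by rw [← mul_assoc, e, one_mul]
  rwa [← this]

end Column


/-! ### Multiplexed single-qubit gates -/

open Matrix

/-- square matrices of size two -/
abbrev M2 := Matrix (Fin 2) (Fin 2) ℂ

section Mux

variable {n : ℕ}

lemma mat_ext {ι : Type} [Fintype ι] [DecidableEq ι] {A B : Matrix ι ι ℂ}
    (h : ∀ v, A *ᵥ v = B *ᵥ v) : A = B := by
  ext i j
  have := congrFun (h (Pi.single j 1)) i
  rw [Matrix.mulVec_single_one, Matrix.mulVec_single_one] at this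
  exact this

/-- The gate which applies to qubit `j` a gate depending on the other qubits. -/
def mux (j : Fin n) (f : (Fin n → Fin 2) → M2) : Matrix (Fin n → Fin 2) (Fin n → Fin 2) ℂ :=
  Matrix.of fun x y => if ∀ i, i ≠ j → x i = y i then f (Function.update x j 0) (x j) (y j) else 0

lemma mux_mulVec (j : Fin n) (f : (Fin n → Fin 2) → M2) (v : (Fin n → Fin 2) → ℂ)
    (x : Fin n → Fin 2) :
    (mux j f *ᵥ v) x = ∑ b, f (Function.update x j 0) (x j) b * v (Function.update x j b) := by
  symm
  apply Fintype.sum_of_injective (fun b => Function.update x j b)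
  · exact Function.update_injective x j
  · intro y hy
    simp only [mux, Matrix.of_apply]
    rw [if_neg, zero_mul]
    intro h
    apply hy
    refine ⟨y j, ?_⟩
    ext1 i
    by_cases hi : i = j
    · subst hi; simp
    · simp [hi, h i hi]
  · intro b
    simp only [mux, Matrix.of_apply]
    rw [if_pos]
    · simp
    · intro i hi; simp [hi]

lemma mux_mul (j : Fin n) (f g : (Fin n → Fin 2) → M2) :
    mux j f * mux j g = mux j (fun z => f z * g z) := by
  apply mat_ext
  intro v
  ext x
  rw [← Matrix.mulVec_mulVec]
  simp only [mux_mulVec, Fin.sum_univ_two, Matrix.mul_apply, Function.update_idem,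
    Function.update_self]
  ring

lemma mux_one (j : Fin n) : mux j (fun _ => 1) = 1 := by
  apply mat_ext
  intro v
  ext x
  rw [mux_mulVec, Matrix.one_mulVec]
  simp [Matrix.one_apply]

lemma mux_star (j : Fin n) (f : (Fin n → Fin 2) → M2) :
    (mux j f)ᴴ = mux j (fun z => (f z)ᴴ) := by
  ext x y
  simp only [mux, Matrix.conjTranspose_apply, Matrix.of_apply]
  by_cases h : ∀ i, i ≠ j → x i = y i
  · rw [if_pos h, if_pos (fun i hi => (h i hi).symm)]
    have : Function.update y j 0 = Function.update x j 0 := by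
      ext1 i
      by_cases hi : i = j
      · subst hi; simp
      · simp [hi, h i hi]
    rw [this]
  · rw [if_neg h, if_neg (fun h' => h fun i hi => (h' i hi).symm), star_zero]

lemma mux_unitary (j : Fin n) (f : (Fin n → Fin 2) → M2) (h : ∀ z, (f z)ᴴ * f z = 1) :
    mux j f ∈ Matrix.unitaryGroup (Fin n → Fin 2) ℂ := by
  rw [Matrix.mem_unitaryGroup_iff']
  show (mux j f)ᴴ * mux j f = 1
  rw [mux_star, mux_mul]
  simp only [h]
  exact mux_one j

lemma mux_diag (j : Fin n) (d : (Fin n → Fin 2) → Fin 2 → ℂ) :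
    mux j (fun z => Matrix.diagonal (d z)) =
      Matrix.diagonal (fun x => d (Function.update x j 0) (x j)) := by
  apply mat_ext
  intro v
  ext x
  rw [mux_mulVec, Matrix.mulVec_diagonal]
  simp [Matrix.diagonal_apply]

lemma app1_eq_mux (G : M2) (j : Fin n) : app1 G j = mux j (fun _ => G) := rfl

lemma cnot_eq_mux {k j : Fin n} (h : k ≠ j) :
    app2 CNOTmat k j = mux j (fun z => if z k = 1 then Xmat else 1) := by
  ext x y
  simp only [app2, mux, CNOTmat, Matrix.of_apply, Function.update_of_ne h]
  by_cases hk : x k = y k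
  · have e : (∀ i, i ≠ k → i ≠ j → x i = y i) ↔ ∀ i, i ≠ j → x i = y i := by
      constructor
      · intro h1 i hi
        by_cases hik : i = k
        · subst hik; exact hk
        · exact h1 i hik hi
      · intro h1 i _ hi; exact h1 i hi
    simp only [e, hk, true_and]
    congr 1
    generalize x j = a
    generalize y j = b
    generalize y k = c
    fin_cases a <;> fin_cases b <;> fin_cases c <;> simp [Xmat]
  · have e : ¬ ∀ i, i ≠ j → x i = y i := fun h1 => hk (h1 k h)
    simp [hk, e]

/-! ### 2×2 identities -/

lemma Hmat_eq : Hmat = !![rr, rr; rr, -rr] := by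
  unfold Hmat rr; ext i j; fin_cases i <;> fin_cases j <;> simp

lemma Smat_eq : Smat = !![1, 0; 0, ω ^ 2] := by
  unfold Smat; rw [om_sq]

lemma star_om_pow (m : ℕ) : star (ω ^ m) = (-ω ^ 3) ^ m := by rw [star_pow, star_om]

lemma Hmat_star : Hmatᴴ = Hmat := by
  rw [Hmat_eq]; ext i j; fin_cases i <;> fin_cases j <;> simpa using star_rr

lemma Smat_star : Smatᴴ = !![1, 0; 0, -ω ^ 2] := by
  have : star (ω ^ 2) = -ω ^ 2 := by
    rw [star_om_pow]; linear_combination ω ^ 2 * om_four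
  rw [Smat_eq]; ext i j; fin_cases i <;> fin_cases j <;> simp
  simpa using this

lemma Tmat_star : Tmatᴴ = !![1, 0; 0, -ω ^ 3] := by
  unfold Tmat; ext i j; fin_cases i <;> fin_cases j <;> simp
  simpa using star_om

lemma Xmat_star : Xmatᴴ = Xmat := by
  unfold Xmat; ext i j; fin_cases i <;> fin_cases j <;> simp

/-- `i X` -/
def iX : M2 := !![0, ω ^ 2; ω ^ 2, 0]
/-- `i Z` -/
def iZ : M2 := !![ω ^ 2, 0; 0, -ω ^ 2]
/-- `i H` -/
def iH : M2 := !![ω ^ 2 * rr, ω ^ 2 * rr; ω ^ 2 * rr, -ω ^ 2 * rr]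
/-- `ω⁻¹ S` -/
def Wm : M2 := !![-ω ^ 3, 0; 0, ω]

lemma iX_star : iXᴴ = !![0, -ω ^ 2; -ω ^ 2, 0] := by
  have : star (ω ^ 2) = -ω ^ 2 := by
    rw [star_om_pow]; linear_combination ω ^ 2 * om_four
  unfold iX; ext i j; fin_cases i <;> fin_cases j <;> simp <;> simpa using this

lemma iH_star : iHᴴ = !![-ω ^ 2 * rr, -ω ^ 2 * rr; -ω ^ 2 * rr, ω ^ 2 * rr] := by
  have h : star (ω ^ 2) = -ω ^ 2 := by
    rw [star_om_pow]; linear_combination ω ^ 2 * om_four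
  have h2 := star_rr
  have h3 : star (ω ^ 2 * rr) = -ω ^ 2 * rr := by rw [star_mul', h, h2]
  unfold iH; ext i j; fin_cases i <;> fin_cases j <;> simp <;>
    simpa [neg_eq_iff_eq_neg] using h3

lemma rr_om : rr = (ω - ω ^ 3) / 2 := by
  unfold rr
  rw [← sqrt2_om, inv_eq_iff_eq_inv, inv_div, eq_div_iff sqrt2_ne, ← sq, sqrt2_sq]

lemma m2_one : (1 : M2) = !![1, 0; 0, 1] := Matrix.one_fin_two

lemma m2_ext {a b c d a' b' c' d' : ℂ} (h1 : a = a') (h2 : b = b') (h3 : c = c') (h4 : d = d') :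
    !![a, b; c, d] = !![a', b'; c', d'] := by subst h1 h2 h3 h4; rfl

lemma HH : Hmat * Hmat = 1 := by
  rw [Hmat_eq, m2_one, Matrix.mul_fin_two]
  have := rr_sq
  apply m2_ext <;> grind

lemma SS : Smat * Smatᴴ = 1 := by
  rw [Smat_star, Smat_eq, m2_one, Matrix.mul_fin_two]
  have := om_four
  apply m2_ext <;> grind

lemma SS' : Smatᴴ * Smat = 1 := by
  rw [Smat_star, Smat_eq, m2_one, Matrix.mul_fin_two]
  have := om_four
  apply m2_ext <;> grind

lemma TT : Tmat * Tmatᴴ = 1 := by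
  rw [Tmat_star, Tmat, m2_one, Matrix.mul_fin_two]
  have := om_four
  apply m2_ext <;> grind

lemma TT' : Tmatᴴ * Tmat = 1 := by
  rw [Tmat_star, Tmat, m2_one, Matrix.mul_fin_two]
  have := om_four
  apply m2_ext <;> grind

lemma TTS : Tmat * Tmat = Smat := by
  rw [Tmat, Smat_eq, Matrix.mul_fin_two]
  apply m2_ext <;> grind

lemma XX : Xmat * Xmat = 1 := by
  rw [Xmat, m2_one, Matrix.mul_fin_two]
  apply m2_ext <;> grind

lemma iXX : iX * iXᴴ = 1 := by
  rw [iX_star, iX, m2_one, Matrix.mul_fin_two]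
  have := om_four
  apply m2_ext <;> grind

lemma cs_id : (ω • (1 : M2)) * Tmat * Xmat * Tmatᴴ * Xmat = Smat := by
  rw [Tmat_star, Tmat, Xmat, Smat_eq, m2_one]
  simp only [Matrix.mul_fin_two, Matrix.smul_of, Matrix.smul_cons, Matrix.smul_empty, smul_eq_mul]
  have := om_four
  apply m2_ext <;> grind

lemma iX_id : (ω • (1 : M2)) * (ω • (1 : M2)) * (Hmat * Smat * Smat * Hmat) = iX := by
  rw [Hmat_eq, Smat_eq, iX, m2_one]
  simp only [Matrix.mul_fin_two, Matrix.smul_of, Matrix.smul_cons, Matrix.smul_empty, smul_eq_mul]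
  have := om_four
  have := rr_sq
  apply m2_ext <;> grind

lemma comm_id : Hmat * (iX * Smat * iXᴴ * Smatᴴ) * Hmat = iX := by
  rw [Hmat_eq, iX_star, Smat_star, Smat_eq, iX]
  simp only [Matrix.mul_fin_two]
  have := om_four
  have := rr_sq
  apply m2_ext <;> grind

lemma iZ_id : Hmat * iX * Hmat = iZ := by
  rw [Hmat_eq, iX, iZ]
  simp only [Matrix.mul_fin_two]
  have := om_four
  have := rr_sq
  apply m2_ext <;> grind

lemma W_id : Tmat * iX * Tmatᴴ * iXᴴ = Wm := by
  rw [iX_star, Tmat_star, Tmat, iX, Wm]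
  simp only [Matrix.mul_fin_two]
  have := om_four
  apply m2_ext <;> grind

lemma iH_id : iX * iX * (Wm * (Hmat * Wm * Hmat) * Wm) = iH := by
  rw [Hmat_eq, iX, Wm, iH]
  simp only [Matrix.mul_fin_two]
  have := om_four
  have h := rr_om
  generalize rr = r at *
  subst h
  apply m2_ext <;> grind

lemma conjH_id : Tmat * iH * Tmatᴴ * iHᴴ * Hmat = Tmat * Hmat * Tmatᴴ := by
  rw [iH_star, Tmat_star, Tmat, iH, Hmat_eq]
  simp only [Matrix.mul_fin_two]
  have := om_four
  have := rr_sq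
  apply m2_ext <;> grind

lemma conjX_id : Tmat * iX * Tmatᴴ * iXᴴ * Xmat = Tmat * Xmat * Tmatᴴ := by
  rw [iX_star, Tmat_star, Tmat, iX, Xmat]
  simp only [Matrix.mul_fin_two]
  have := om_four
  apply m2_ext <;> grind

end Mux


/-! ### The Clifford+T group contains multiply controlled gates -/

open Matrix

section Clif

variable {n : ℕ}

/-- membership of a matrix in the Clifford+T group -/
def inC (M : Matrix (Fin n → Fin 2) (Fin n → Fin 2) ℂ) : Prop :=
  ∃ V ∈ CliffordT n, (V : Matrix (Fin n → Fin 2) (Fin n → Fin 2) ℂ) = M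

lemma inC.one : inC (1 : Matrix (Fin n → Fin 2) (Fin n → Fin 2) ℂ) :=
  ⟨1, (CliffordT n).one_mem, rfl⟩

lemma inC.mul {A B : Matrix (Fin n → Fin 2) (Fin n → Fin 2) ℂ} (hA : inC A) (hB : inC B) :
    inC (A * B) := by
  obtain ⟨V, hV, rfl⟩ := hA
  obtain ⟨W, hW, rfl⟩ := hB
  exact ⟨V * W, (CliffordT n).mul_mem hV hW, rfl⟩

lemma inC.star {A : Matrix (Fin n → Fin 2) (Fin n → Fin 2) ℂ} (hA : inC A) :
    inC Aᴴ := by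
  obtain ⟨V, hV, rfl⟩ := hA
  exact ⟨V⁻¹, (CliffordT n).inv_mem hV, rfl⟩

lemma inC.pow {A : Matrix (Fin n → Fin 2) (Fin n → Fin 2) ℂ} (hA : inC A) (m : ℕ) :
    inC (A ^ m) := by
  induction m with
  | zero => rw [pow_zero]; exact inC.one
  | succ m ih => rw [pow_succ]; exact ih.mul hA

lemma inC.unitary {A : Matrix (Fin n → Fin 2) (Fin n → Fin 2) ℂ} (hA : inC A) :
    A ∈ Matrix.unitaryGroup (Fin n → Fin 2) ℂ := by
  obtain ⟨V, hV, rfl⟩ := hA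
  exact V.2

/-- the generating matrices -/
def IsGen (M : Matrix (Fin n → Fin 2) (Fin n → Fin 2) ℂ) : Prop :=
  M = ω • (1 : Matrix (Fin n → Fin 2) (Fin n → Fin 2) ℂ)
      ∨ (∃ j, M = app1 Hmat j) ∨ (∃ j, M = app1 Smat j) ∨ (∃ j, M = app1 Tmat j)
      ∨ (∃ j l, j ≠ l ∧ M = app2 CNOTmat j l)

lemma inC.gen {M : Matrix (Fin n → Fin 2) (Fin n → Fin 2) ℂ} (h : IsGen M)
    (hu : M ∈ Matrix.unitaryGroup (Fin n → Fin 2) ℂ) : inC M :=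
  ⟨⟨M, hu⟩, Subgroup.subset_closure h, rfl⟩

lemma inC.induction {P : Matrix (Fin n → Fin 2) (Fin n → Fin 2) ℂ → Prop}
    (hg : ∀ M, IsGen M → inC M → P M) (h1 : P 1)
    (hm : ∀ A B, inC A → inC B → P A → P B → P (A * B))
    (hs : ∀ A, inC A → P A → P Aᴴ) {M : Matrix (Fin n → Fin 2) (Fin n → Fin 2) ℂ}
    (h : inC M) : P M := by
  obtain ⟨V, hV, rfl⟩ := h
  unfold CliffordT at hV
  induction hV using Subgroup.closure_induction with
  | mem x hx => exact hg _ hx ⟨x, Subgroup.subset_closure hx, rfl⟩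
  | one => exact h1
  | mul x y hx hy ihx ihy => exact hm _ _ ⟨x, hx, rfl⟩ ⟨y, hy, rfl⟩ ihx ihy
  | inv x hx ih => exact hs _ ⟨x, hx, rfl⟩ ih

/-- `mux j f` is in the Clifford+T group -/
def MC (j : Fin n) (f : (Fin n → Fin 2) → M2) : Prop := inC (mux j f)

variable {j : Fin n} {f g : (Fin n → Fin 2) → M2}

lemma MC.mul (hf : MC j f) (hg : MC j g) : MC j (fun z => f z * g z) := by
  have := inC.mul hf hg
  rwa [mux_mul] at this

lemma MC.star (hf : MC j f) : MC j (fun z => (f z)ᴴ) := by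
  have := inC.star hf
  rwa [mux_star] at this

lemma MC.congr (hf : MC j f) (h : ∀ z, f z = g z) : MC j g := by
  have : f = g := funext h
  rwa [← this]

lemma om_smul_unitary {ι : Type} [Fintype ι] [DecidableEq ι] :
    ω • (1 : Matrix ι ι ℂ) ∈ Matrix.unitaryGroup ι ℂ := by
  rw [Matrix.mem_unitaryGroup_iff', star_smul, star_one, smul_mul_smul_comm, star_om_mul, one_mul,
    one_smul]

lemma inC_om : inC (ω • (1 : Matrix (Fin n → Fin 2) (Fin n → Fin 2) ℂ)) :=
  inC.gen (Or.inl rfl) om_smul_unitary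

lemma MC.om (j : Fin n) : MC j (fun _ => ω • (1 : M2)) := by
  have e : mux j (fun _ => ω • (1 : M2)) = ω • (1 : Matrix (Fin n → Fin 2) (Fin n → Fin 2) ℂ) := by
    rw [← mux_one j]; ext x y; simp [mux]
  unfold MC; rw [e]; exact inC_om

lemma MC.H (j : Fin n) : MC j (fun _ => Hmat) :=
  inC.gen (Or.inr (Or.inl ⟨j, rfl⟩)) (mux_unitary j _ fun _ => by rw [Hmat_star, HH])

lemma MC.S (j : Fin n) : MC j (fun _ => Smat) :=
  inC.gen (Or.inr (Or.inr (Or.inl ⟨j, rfl⟩))) (mux_unitary j _ fun _ => SS')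

lemma MC.T (j : Fin n) : MC j (fun _ => Tmat) :=
  inC.gen (Or.inr (Or.inr (Or.inr (Or.inl ⟨j, rfl⟩)))) (mux_unitary j _ fun _ => TT')

lemma MC.cx {k j : Fin n} (h : k ≠ j) : MC j (fun z => if z k = 1 then Xmat else 1) :=
  inC.gen (Or.inr (Or.inr (Or.inr (Or.inr ⟨k, j, h, (cnot_eq_mux h).symm⟩))))
    (mux_unitary j _ fun z => by split_ifs <;> simp [Xmat_star, XX])

lemma Tmat_diag : Tmat = Matrix.diagonal ![1, ω] := by
  unfold Tmat; ext i j; fin_cases i <;> fin_cases j <;> simp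

lemma Smat_diag : Smat = Matrix.diagonal ![1, ω ^ 2] := by
  rw [Smat_eq]; ext i j; fin_cases i <;> fin_cases j <;> simp

lemma MC.cphase {k j : Fin n} (h : k ≠ j) :
    MC j (fun z => if z k = 1 then ω • (1 : M2) else 1) := by
  have e : mux j (fun z => if z k = 1 then ω • (1 : M2) else 1) = mux k (fun _ => Tmat) := by
    have e1 : (fun z : Fin n → Fin 2 => if z k = 1 then ω • (1 : M2) else 1) =
        fun z => Matrix.diagonal (fun _ => if z k = 1 then ω else 1) := by
      funext z
      split_ifs
      · ext i j; simp [Matrix.diagonal_apply, Matrix.one_apply]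
      · ext i j; simp [Matrix.diagonal_apply, Matrix.one_apply]
    rw [e1, Tmat_diag, mux_diag, mux_diag]
    congr 1
    funext x
    rw [Function.update_of_ne h]
    generalize x k = a
    fin_cases a <;> simp
  unfold MC; rw [e]; exact MC.T k

lemma MC.cs1 {k j : Fin n} (h : k ≠ j) : MC j (fun z => if z k = 1 then Smat else 1) := by
  refine (((((MC.cphase h).mul (MC.T j)).mul (MC.cx h)).mul (MC.T j).star).mul (MC.cx h)).congr ?_
  intro z
  by_cases hz : z k = 1
  · simp only [hz, if_true]; exact cs_id
  · simp only [hz, if_false]; simp [TT]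

lemma MC.cs {k j : Fin n} (h : k ≠ j) (p : Fin n → Fin 2) :
    MC j (fun z => if z k = p k then Smat else 1) := by
  by_cases hp : p k = 1
  · simp only [hp]; exact MC.cs1 h
  · refine ((MC.S j).mul (MC.cs1 h).star).congr ?_
    intro z
    have hp0 : p k = 0 := by omega
    by_cases hz : z k = 1
    · simp [hz, hp0, SS]
    · have hz0 : z k = 0 := by omega
      simp [hz0, hp0]

/-- the gate controlled by the pattern `p` on the qubits in `K` -/
def ctl (K : Finset (Fin n)) (p : Fin n → Fin 2) (A : M2) : (Fin n → Fin 2) → M2 :=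
  fun z => if ∀ k ∈ K, z k = p k then A else 1

lemma MC.iX_const (j : Fin n) : MC j (fun _ => iX) :=
  ((((MC.om j).mul (MC.om j)).mul ((((MC.H j).mul (MC.S j)).mul (MC.S j)).mul (MC.H j)))).congr
    fun _ => iX_id

lemma MC.ciX (p : Fin n → Fin 2) (j : Fin n) (K : Finset (Fin n)) (hK : j ∉ K) :
    MC j (ctl K p iX) := by
  induction K using Finset.induction_on with
  | empty => exact (MC.iX_const j).congr fun z => by simp [ctl]
  | insert k K hk ih =>
    simp only [Finset.mem_insert, not_or] at hK
    have h1 := ih hK.2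
    have h2 := MC.cs (Ne.symm hK.1) p
    refine (((MC.H j).mul (((h1.mul h2).mul h1.star).mul h2.star)).mul (MC.H j)).congr ?_
    intro z
    simp only [ctl, Finset.forall_mem_insert]
    by_cases a : z k = p k <;> by_cases b : ∀ k ∈ K, z k = p k
    · simp only [a, if_pos b, true_and, if_true]; exact comm_id
    · simp only [a, if_neg b, true_and, if_true]; simp [SS, HH]
    · simp only [a, if_pos b, false_and, if_false]; simp [iXX, HH]
    · simp only [a, if_neg b, false_and, if_false]; simp [HH]

lemma MC.cW (p : Fin n → Fin 2) (j : Fin n) (K : Finset (Fin n)) (hK : j ∉ K) :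
    MC j (ctl K p Wm) := by
  have h := MC.ciX p j K hK
  refine ((((MC.T j).mul h).mul (MC.T j).star).mul h.star).congr ?_
  intro z
  simp only [ctl]
  split_ifs
  · exact W_id
  · simp [TT]

lemma MC.ciZ (p : Fin n → Fin 2) (j : Fin n) (K : Finset (Fin n)) (hK : j ∉ K) :
    MC j (ctl K p iZ) := by
  refine (((MC.H j).mul (MC.ciX p j K hK)).mul (MC.H j)).congr ?_
  intro z
  simp only [ctl]
  split_ifs
  · exact iZ_id
  · simp [HH]

lemma MC.ciH (p : Fin n → Fin 2) (j : Fin n) (K : Finset (Fin n)) (hK : j ∉ K) :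
    MC j (ctl K p iH) := by
  have h := MC.ciX p j K hK
  have w := MC.cW p j K hK
  refine ((h.mul h).mul ((w.mul (((MC.H j).mul w).mul (MC.H j))).mul w)).congr ?_
  intro z
  simp only [ctl]
  split_ifs
  · exact iH_id
  · simp [HH]

/-! ### The normalising phase -/

/-- full control -/
abbrev full (j : Fin n) : Finset (Fin n) := Finset.univ.erase j

lemma full_iff (j : Fin n) (p x : Fin n → Fin 2) (b : Fin 2) :
    (∀ k ∈ full j, Function.update x j b k = p k) ↔ ∀ k, k ≠ j → x k = p k := by
  constructor
  · intro h k hk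
    have := h k (by simp [hk])
    rwa [Function.update_of_ne hk] at this
  · intro h k hk
    have hk' : k ≠ j := by simpa using hk
    rw [Function.update_of_ne hk']; exact h k hk'

lemma mux_full_mulVec (j : Fin n) (p : Fin n → Fin 2) (A : M2) (v : (Fin n → Fin 2) → ℂ) :
    mux j (ctl (full j) p A) *ᵥ v =
      Function.update (Function.update v (Function.update p j 0)
        (A 0 0 * v (Function.update p j 0) + A 0 1 * v (Function.update p j 1)))
        (Function.update p j 1)
        (A 1 0 * v (Function.update p j 0) + A 1 1 * v (Function.update p j 1)) := by
  ext x
  rw [mux_mulVec]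
  simp only [ctl, full_iff]
  have h01 : Function.update p j 0 ≠ Function.update p j 1 := by
    intro h; have := congrFun h j; simp at this
  by_cases h : ∀ k, k ≠ j → x k = p k
  · rw [if_pos h]
    have e : ∀ b, Function.update x j b = Function.update p j b := by
      intro b; ext1 i
      by_cases hi : i = j
      · subst hi; simp
      · simp [hi, h i hi]
    have ex : x = Function.update p j (x j) := by rw [← e, Function.update_eq_self]
    rw [Fin.sum_univ_two, e, e]
    rcases (show x j = 0 ∨ x j = 1 by omega) with hx | hx
    · rw [hx] at ex ⊢
      rw [ex, Function.update_of_ne h01, Function.update_self]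
    · rw [hx] at ex ⊢
      rw [ex, Function.update_self]
  · rw [if_neg h]
    have hne : ∀ b, x ≠ Function.update p j b := by
      rintro b rfl
      exact h fun k hk => by simp [hk]
    rw [Function.update_of_ne (hne 1), Function.update_of_ne (hne 0)]
    simp [Matrix.one_apply]

/-- all ones -/
def p1 (n : ℕ) : Fin n → Fin 2 := fun _ => 1

/-- The phase operator `D`. -/
def Dm (n : ℕ) : Matrix (Fin n → Fin 2) (Fin n → Fin 2) ℂ := ph (p1 n) ω

lemma Dm_eq (j : Fin n) : Dm n = mux j (ctl (full j) (p1 n) Tmat) := by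
  apply mat_ext
  intro v
  have e : Function.update (p1 n) j 1 = p1 n := Function.update_eq_self j (p1 n)
  rw [mux_full_mulVec, Dm, ph_mulVec, e]
  simp [Tmat]

lemma ph_star {ι : Type} [DecidableEq ι] (x : ι) (c : ℂ) :
    (ph x c)ᴴ = ph x (star c) := by
  unfold ph
  rw [Matrix.diagonal_conjTranspose]
  congr 1
  ext i
  by_cases h : i = x
  · subst h; simp
  · simp [h]

lemma ph_mul {ι : Type} [Fintype ι] [DecidableEq ι] (x : ι) (c d : ℂ) :
    ph x c * ph x d = ph x (c * d) := by
  unfold ph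
  rw [Matrix.diagonal_mul_diagonal]
  congr 1
  ext i
  by_cases h : i = x
  · subst h; simp
  · simp [h]

lemma ph_one {ι : Type} [DecidableEq ι] (x : ι) : ph x 1 = 1 := by
  unfold ph
  rw [← Matrix.diagonal_one]
  congr 1
  ext i
  by_cases h : i = x
  · subst h; simp
  · simp [h]

lemma ph_pow {ι : Type} [Fintype ι] [DecidableEq ι] (x : ι) (c : ℂ) (m : ℕ) :
    ph x c ^ m = ph x (c ^ m) := by
  induction m with
  | zero => simp [ph_one]
  | succ m ih => rw [pow_succ, ih, ph_mul, pow_succ]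

lemma Dm_star_mul : (Dm n)ᴴ * Dm n = 1 := by
  rw [Dm, ph_star, ph_mul, star_om_mul, ph_one]

lemma Dm_mul_star : Dm n * (Dm n)ᴴ = 1 := by
  rw [Dm, ph_star, ph_mul, mul_comm, star_om_mul, ph_one]

lemma conj_mux (j : Fin n) (f : (Fin n → Fin 2) → M2) :
    Dm n * mux j f * (Dm n)ᴴ =
      mux j (fun z => ctl (full j) (p1 n) Tmat z * f z * (ctl (full j) (p1 n) Tmat z)ᴴ) := by
  rw [Dm_eq j, mux_star, mux_mul, mux_mul]

lemma conj_inC {M : Matrix (Fin n → Fin 2) (Fin n → Fin 2) ℂ} (h : inC M) :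
    inC (Dm n * M * (Dm n)ᴴ) := by
  refine inC.induction (P := fun M => inC (Dm n * M * (Dm n)ᴴ)) ?_ ?_ ?_ ?_ h
  · intro M hM hM'
    rcases hM with rfl | ⟨j, rfl⟩ | ⟨j, rfl⟩ | ⟨j, rfl⟩ | ⟨k, j, hkj, rfl⟩
    · rw [mul_smul_comm, mul_one, smul_mul_assoc, Dm_mul_star]; exact hM'
    · rw [app1_eq_mux, conj_mux]
      have h := MC.ciH (p1 n) j (full j) (by simp)
      refine (((((MC.T j).mul h).mul (MC.T j).star).mul h.star).mul (MC.H j)).congr ?_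
      intro z
      simp only [ctl]
      split_ifs
      · exact conjH_id
      · simp [TT]
    · rw [app1_eq_mux, conj_mux]
      refine (MC.S j).congr ?_
      intro z
      simp only [ctl]
      split_ifs
      · rw [← TTS, mul_assoc, mul_assoc, TT, mul_one]
      · simp
    · rw [app1_eq_mux, conj_mux]
      refine (MC.T j).congr ?_
      intro z
      simp only [ctl]
      split_ifs
      · rw [mul_assoc, TT, mul_one]
      · simp
    · rw [cnot_eq_mux hkj, conj_mux]
      have h := MC.ciX (p1 n) j (full j) (by simp)
      refine (((((MC.T j).mul h).mul (MC.T j).star).mul h.star).mul (MC.cx hkj)).congr ?_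
      intro z
      simp only [ctl]
      by_cases a : ∀ k ∈ full j, z k = p1 n k
      · have b : z k = 1 := a k (by simp [hkj])
        rw [if_pos a, if_pos a, if_pos b]
        exact conjX_id
      · rw [if_neg a, if_neg a]
        simp [TT]
  · rw [mul_one, Dm_mul_star]; exact inC.one
  · intro A B hA hB ihA ihB
    have : Dm n * (A * B) * (Dm n)ᴴ = Dm n * A * (Dm n)ᴴ * (Dm n * B * (Dm n)ᴴ) := by
      calc Dm n * (A * B) * (Dm n)ᴴ = Dm n * A * 1 * B * (Dm n)ᴴ := by
            rw [mul_one]; simp only [mul_assoc]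
        _ = _ := by rw [← Dm_star_mul]; simp only [mul_assoc]
    rw [this]; exact ihA.mul ihB
  · intro A hA ih
    have := ih.star
    simpa [Matrix.conjTranspose_mul, mul_assoc] using this

lemma conj_pow_inC {M : Matrix (Fin n → Fin 2) (Fin n → Fin 2) ℂ} (h : inC M) (a : ℕ) :
    ∃ M', inC M' ∧ Dm n ^ a * M = M' * Dm n ^ a := by
  induction a with
  | zero => exact ⟨M, h, by simp⟩
  | succ a ih =>
    obtain ⟨M', h', e⟩ := ih
    refine ⟨Dm n * M' * (Dm n)ᴴ, conj_inC h', ?_⟩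
    rw [pow_succ', mul_assoc, e]
    simp only [mul_assoc]
    congr 2
    rw [← mul_assoc, Dm_star_mul, one_mul]

/-- `C · ⟨D⟩` -/
def Gam (n : ℕ) : Submonoid (Matrix (Fin n → Fin 2) (Fin n → Fin 2) ℂ) where
  carrier := {M | ∃ c, inC c ∧ ∃ k : ℕ, M = c * Dm n ^ k}
  one_mem' := ⟨1, inC.one, 0, by simp⟩
  mul_mem' := by
    rintro _ _ ⟨c, hc, k, rfl⟩ ⟨c', hc', k', rfl⟩
    obtain ⟨d, hd, e⟩ := conj_pow_inC hc' k
    refine ⟨c * d, hc.mul hd, k + k', ?_⟩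
    rw [pow_add, mul_assoc, ← mul_assoc (Dm n ^ k), e]
    simp only [mul_assoc]

lemma inC.gam {M : Matrix (Fin n → Fin 2) (Fin n → Fin 2) ℂ} (h : inC M) : M ∈ Gam n :=
  ⟨M, h, 0, by simp⟩

end Clif


/-! ### The group `C·⟨D⟩` contains all one- and two-level operators -/

open Matrix

section GoodGam

variable {n : ℕ}

lemma mux_ent (j : Fin n) (f : (Fin n → Fin 2) → M2) (h : ∀ z a b, f z a b ∈ RD) (x y) :
    mux j f x y ∈ RD := by
  simp only [mux, Matrix.of_apply]
  split_ifs
  · exact h _ _ _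
  · exact RD.zero_mem

lemma rr_mem : rr ∈ RD := sqrt2_inv_mem
lemma om_memD : ω ∈ RD := RZ_le_RD om_mem

lemma inC_ent {M : Matrix (Fin n → Fin 2) (Fin n → Fin 2) ℂ} (h : inC M) :
    ∀ x y, M x y ∈ RD := by
  refine inC.induction (P := fun M => ∀ x y, M x y ∈ RD) ?_ ?_ ?_ ?_ h
  · intro M hM _
    rcases hM with rfl | ⟨j, rfl⟩ | ⟨j, rfl⟩ | ⟨j, rfl⟩ | ⟨k, j, hkj, rfl⟩
    · intro x y
      simp only [Matrix.smul_apply, Matrix.one_apply, smul_eq_mul]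
      split_ifs
      · rw [mul_one]; exact om_memD
      · rw [mul_zero]; exact RD.zero_mem
    · rw [app1_eq_mux]
      refine mux_ent _ _ fun z a b => ?_
      rw [Hmat_eq]
      fin_cases a <;> fin_cases b
      · exact rr_mem
      · exact rr_mem
      · exact rr_mem
      · exact RD.neg_mem rr_mem
    · rw [app1_eq_mux]
      refine mux_ent _ _ fun z a b => ?_
      rw [Smat_eq]
      fin_cases a <;> fin_cases b
      · exact RD.one_mem
      · exact RD.zero_mem
      · exact RD.zero_mem
      · exact RD.pow_mem om_memD 2
    · rw [app1_eq_mux]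
      refine mux_ent _ _ fun z a b => ?_
      unfold Tmat
      fin_cases a <;> fin_cases b
      · exact RD.one_mem
      · exact RD.zero_mem
      · exact RD.zero_mem
      · exact om_memD
    · intro x y
      simp only [app2, CNOTmat, Matrix.of_apply]
      split_ifs
      · exact RD.one_mem
      · exact RD.zero_mem
      · exact RD.zero_mem
  · intro x y
    rw [Matrix.one_apply]
    split_ifs
    · exact RD.one_mem
    · exact RD.zero_mem
  · intro A B _ _ hA hB x y
    rw [Matrix.mul_apply]
    exact RD.sum_mem fun z _ => RD.mul_mem (hA _ _) (hB _ _)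
  · intro A _ hA x y
    rw [Matrix.conjTranspose_apply]
    exact star_mem_RD (hA _ _)

lemma ph_ent {ι : Type} [Fintype ι] [DecidableEq ι] (x : ι) (c : ℂ) (hc : c ∈ RD) (i j : ι) :
    ph x c i j ∈ RD := by
  simp only [ph, Matrix.diagonal_apply, Function.update_apply]
  split_ifs
  · exact hc
  · exact RD.one_mem
  · exact RD.zero_mem

lemma connect {Q : (Fin n → Fin 2) → Prop} (h : ∀ p j b, Q p → Q (Function.update p j b))
    {p : Fin n → Fin 2} (hp : Q p) (x : Fin n → Fin 2) : Q x := by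
  have : ∀ s : Finset (Fin n), Q (s.piecewise x p) := by
    intro s
    induction s using Finset.induction_on with
    | empty => simpa using hp
    | insert a s ha ih =>
      rw [Finset.piecewise_insert]
      exact h _ _ _ ih
  have := this Finset.univ
  simpa using this

lemma connect_adj {Q : (Fin n → Fin 2) → Prop}
    (h : ∀ p j, Q (Function.update p j 0) ↔ Q (Function.update p j 1))
    {p : Fin n → Fin 2} (hp : Q p) (x : Fin n → Fin 2) : Q x := by
  refine connect ?_ hp x
  intro p j b hq
  have hall : Q (Function.update p j 0) ∧ Q (Function.update p j 1) := by
    have e : p = Function.update p j (p j) := (Function.update_eq_self j p).symm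
    rcases (show p j = 0 ∨ p j = 1 by omega) with hx | hx
    · rw [hx] at e; rw [e] at hq
      exact ⟨hq, (h p j).1 hq⟩
    · rw [hx] at e; rw [e] at hq
      exact ⟨(h p j).2 hq, hq⟩
  rcases (show b = 0 ∨ b = 1 by omega) with rfl | rfl
  · exact hall.1
  · exact hall.2

lemma upd_ne (p : Fin n → Fin 2) (j : Fin n) :
    Function.update p j 0 ≠ Function.update p j 1 := by
  intro h; have := congrFun h j; simp at this

lemma W_eq (p : Fin n → Fin 2) (j : Fin n) :
    mux j (ctl (full j) p Wm) = ph (Function.update p j 0) (ω ^ 7) * ph (Function.update p j 1) ω := by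
  apply mat_ext
  intro v
  have h := upd_ne p j
  have e7 : ω ^ 7 = -ω ^ 3 := by linear_combination ω ^ 3 * om_four
  rw [mux_full_mulVec, ← Matrix.mulVec_mulVec, ph_mulVec, ph_mulVec, e7]
  ext i
  by_cases h1 : i = Function.update p j 1
  · subst h1; simp [Wm, h, Ne.symm h]
  · by_cases h2 : i = Function.update p j 0
    · subst h2; simp [Wm, h]
    · simp [h1, h2]

lemma ph_mul8 {ι : Type} [Fintype ι] [DecidableEq ι] (x : ι) : ph x (ω ^ 7) * ph x ω = 1 := by
  rw [ph_mul, ← pow_succ, om_eight, ph_one]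

lemma ph_mul8' {ι : Type} [Fintype ι] [DecidableEq ι] (x : ι) : ph x ω * ph x (ω ^ 7) = 1 := by
  rw [ph_mul, ← pow_succ', om_eight, ph_one]

lemma gam_ph (x : Fin n → Fin 2) : ph x ω ∈ Gam n := by
  refine connect_adj (Q := fun x => ph x ω ∈ Gam n) ?_ (p := p1 n) ?_ x
  · intro p j
    have hW : mux j (ctl (full j) p Wm) ∈ Gam n := (MC.cW p j (full j) (by simp)).gam
    rw [W_eq] at hW
    constructor
    · intro h
      have := (Gam n).mul_mem h hW
      rwa [← mul_assoc, ph_mul8', one_mul] at this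
    · intro h
      have h7 : ph (Function.update p j 1) (ω ^ 7) ∈ Gam n := by
        rw [← ph_pow]; exact (Gam n).pow_mem h 7
      have := (Gam n).mul_mem hW h7
      rw [mul_assoc, ph_mul8', mul_one] at this
      have := (Gam n).pow_mem this 7
      rw [ph_pow] at this
      convert this using 2
      linear_combination (-ω * (ω^40 + ω^32+ω^24+ω^16+ω^8+1)) * om_eight
  · exact ⟨1, inC.one, 1, by simp [Dm]⟩

lemma gam_ph_pow (x : Fin n → Fin 2) (m : ℕ) : ph x (ω ^ m) ∈ Gam n := by
  rw [← ph_pow]; exact (Gam n).pow_mem (gam_ph x) m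

/-- two-level swap -/
def sw {ι : Type} [Fintype ι] [DecidableEq ι] (x y : ι) : Matrix ι ι ℂ :=
  hd x y * ph y (ω ^ 4) * hd x y

lemma sw_mulVec {ι : Type} [Fintype ι] [DecidableEq ι] (x y : ι) (h : x ≠ y) (v : ι → ℂ) :
    sw x y *ᵥ v = Function.update (Function.update v x (v y)) y (v x) := by
  have := rr_sq
  rw [sw, ← Matrix.mulVec_mulVec, ← Matrix.mulVec_mulVec, hd_mulVec x y h, ph_mulVec,
    hd_mulVec x y h, om_four]
  ext i
  by_cases h1 : i = y
  · subst h1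
    simp [h]
    linear_combination (2 * v x) * this
  · by_cases h2 : i = x
    · subst h2; simp [h]
      linear_combination (2 * v y) * this
    · simp [h1, h2]

lemma hd_adj (p : Fin n → Fin 2) (j : Fin n) :
    hd (Function.update p j 0) (Function.update p j 1) =
      ph (Function.update p j 0) (ω ^ 6) * ph (Function.update p j 1) (ω ^ 6) *
        mux j (ctl (full j) p iH) := by
  apply mat_ext
  intro v
  have h := upd_ne p j
  rw [← Matrix.mulVec_mulVec, ← Matrix.mulVec_mulVec, mux_full_mulVec, ph_mulVec, ph_mulVec,
    hd_mulVec _ _ h]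
  ext i
  by_cases h1 : i = Function.update p j 1
  · subst h1
    simp [iH, h, Ne.symm h]
    linear_combination (-rr * (v (Function.update p j 0) - v (Function.update p j 1))) * om_eight
  · by_cases h2 : i = Function.update p j 0
    · subst h2; simp [iH, h]
      linear_combination (-rr * (v (Function.update p j 0) + v (Function.update p j 1))) * om_eight
    · simp [h1, h2]

lemma gam_hd_adj (p : Fin n → Fin 2) (j : Fin n) :
    hd (Function.update p j 0) (Function.update p j 1) ∈ Gam n := by
  rw [hd_adj]
  exact (Gam n).mul_mem ((Gam n).mul_mem (gam_ph_pow _ 6) (gam_ph_pow _ 6))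
    (MC.ciH p j (full j) (by simp)).gam

lemma gam_sw {x y : Fin n → Fin 2} (h : hd x y ∈ Gam n) : sw x y ∈ Gam n :=
  (Gam n).mul_mem ((Gam n).mul_mem h (gam_ph_pow _ 4)) h

section ids
variable {ι : Type} [Fintype ι] [DecidableEq ι]

lemma hd_comm (x y : ι) (h : x ≠ y) : hd y x = sw x y * hd x y * sw x y := by
  apply mat_ext
  intro v
  rw [← Matrix.mulVec_mulVec, ← Matrix.mulVec_mulVec, sw_mulVec x y h, sw_mulVec x y h,
    hd_mulVec x y h, hd_mulVec y x h.symm]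
  ext i
  by_cases h1 : i = y
  · subst h1
    simp [h, h.symm]
  · by_cases h2 : i = x
    · subst h2; simp [h]
    · simp [h1, h2]

lemma sw_comm (x y : ι) (h : x ≠ y) : sw y x = sw x y := by
  apply mat_ext
  intro v
  rw [sw_mulVec x y h, sw_mulVec y x h.symm]
  rw [Function.update_comm h]

lemma hd_move (x y z : ι) (h : x ≠ y) (hz : x ≠ z) (hy : y ≠ z) :
    hd x z = sw y z * hd x y * sw y z := by
  apply mat_ext
  intro v
  rw [← Matrix.mulVec_mulVec, ← Matrix.mulVec_mulVec, sw_mulVec y z hy, sw_mulVec y z hy,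
    hd_mulVec x y h, hd_mulVec x z hz]
  ext i
  by_cases h1 : i = y
  · subst h1
    simp [hz, hy, h, h.symm, hy.symm, hz.symm]
  · by_cases h2 : i = x
    · subst h2; simp [h, hz, hy, h.symm, hy.symm, hz.symm]
    · by_cases h3 : i = z
      · subst h3; simp [h, hz, hy, h.symm, hy.symm, hz.symm]
      · simp [h1, h2, h3]

end ids

lemma gam_move {x y z : Fin n → Fin 2} (hy : y ≠ z) (h : hd y z ∈ Gam n)
    (hQ : x = y ∨ hd x y ∈ Gam n) (h0 : hd z y ∈ Gam n) : x = z ∨ hd x z ∈ Gam n := by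
  by_cases hxz : x = z
  · exact Or.inl hxz
  right
  by_cases hxy : x = y
  · subst hxy; exact h
  have hh := hQ.resolve_left hxy
  rw [hd_move x y z hxy hxz hy]
  exact (Gam n).mul_mem ((Gam n).mul_mem (gam_sw h) hh) (gam_sw h)

lemma gam_hd (x y : Fin n → Fin 2) (h : x ≠ y) : hd x y ∈ Gam n := by
  have key : x = y ∨ hd x y ∈ Gam n := by
    refine connect_adj (Q := fun y => x = y ∨ hd x y ∈ Gam n) ?_ (p := x) (Or.inl rfl) y
    intro p j
    have h1 := gam_hd_adj p j
    have hne := upd_ne p j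
    have h2 : hd (Function.update p j 1) (Function.update p j 0) ∈ Gam n := by
      rw [hd_comm _ _ hne]
      exact (Gam n).mul_mem ((Gam n).mul_mem (gam_sw h1) h1) (gam_sw h1)
    exact ⟨fun hq => gam_move hne h1 hq h2, fun hq => gam_move hne.symm h2 hq h1⟩
  exact key.resolve_left h

lemma Dm_unitary : Dm n ∈ Matrix.unitaryGroup (Fin n → Fin 2) ℂ := by
  rw [Matrix.mem_unitaryGroup_iff']
  exact Dm_star_mul

lemma good_gam : Good (Gam n) where
  unit := by
    rintro _ ⟨c, hc, k, rfl⟩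
    exact mul_mem hc.unitary (pow_mem Dm_unitary k)
  ent := by
    rintro _ ⟨c, hc, k, rfl⟩ x y
    rw [Matrix.mul_apply]
    refine RD.sum_mem fun z _ => RD.mul_mem (inC_ent hc _ _) ?_
    rw [Dm, ph_pow]
    exact ph_ent _ _ (RD.pow_mem om_memD k) _ _
  ph_mem := gam_ph
  hd_mem := gam_hd

end GoodGam


/-! ### Determinants -/

open Matrix

section Dets

variable {n : ℕ}

lemma det_mux (j : Fin n) (f : (Fin n → Fin 2) → M2) :
    (mux j f).det = ∏ z : ({i // i ≠ j} → Fin 2),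
      (f ((Equiv.funSplitAt j (Fin 2)).symm (0, z))).det := by
  rw [← Matrix.det_blockDiagonal, ← Matrix.det_submatrix_equiv_self (Equiv.funSplitAt j (Fin 2))]
  congr 1
  ext x y
  simp only [mux, Matrix.of_apply, Matrix.submatrix_apply, Matrix.blockDiagonal_apply]
  have e1 : ((Equiv.funSplitAt j (Fin 2)) x).2 = ((Equiv.funSplitAt j (Fin 2)) y).2 ↔
      ∀ i, i ≠ j → x i = y i := by
    simp [Equiv.funSplitAt, Equiv.piSplitAt, funext_iff]
  have e2 : (Equiv.funSplitAt j (Fin 2)).symm (0, ((Equiv.funSplitAt j (Fin 2)) x).2) =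
      Function.update x j 0 := by
    ext1 i
    by_cases hi : i = j
    · subst hi; simp [Equiv.funSplitAt, Equiv.piSplitAt]
    · simp [Equiv.funSplitAt, Equiv.piSplitAt, hi]
  rw [e2]
  by_cases h : ∀ i, i ≠ j → x i = y i
  · rw [if_pos h, if_pos (e1.2 h)]; simp [Equiv.funSplitAt, Equiv.piSplitAt]
  · rw [if_neg h, if_neg (fun h' => h (e1.1 h'))]

lemma det_app1 (G : M2) (j : Fin n) : (app1 G j).det = G.det ^ 2 ^ (n - 1) := by
  rw [app1_eq_mux, det_mux]
  simp

lemma prod_ctl {ι : Type} [Fintype ι] [DecidableEq ι] (k : ι) (c : ℂ) :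
    ∏ z : ι → Fin 2, (if z k = 1 then c else 1) = c ^ 2 ^ (Fintype.card ι - 1) := by
  rw [← (Equiv.funSplitAt k (Fin 2)).symm.prod_comp, Fintype.prod_prod_type, Fin.prod_univ_two]
  simp [Equiv.funSplitAt, Equiv.piSplitAt]

lemma det_cnot {k j : Fin n} (h : k ≠ j) : (app2 CNOTmat k j).det = (-1) ^ 2 ^ (n - 2) := by
  rw [cnot_eq_mux h, det_mux]
  have : ∀ z : ({i // i ≠ j} → Fin 2),
      Matrix.det (if (Equiv.funSplitAt j (Fin 2)).symm (0, z) k = 1 then Xmat else (1 : M2)) =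
      if z ⟨k, h⟩ = 1 then -1 else 1 := by
    intro z
    have e : (Equiv.funSplitAt j (Fin 2)).symm (0, z) k = z ⟨k, h⟩ := by
      simp [Equiv.funSplitAt, Equiv.piSplitAt, h]
    rw [e]
    split_ifs
    · simp [Xmat, Matrix.det_fin_two]
    · simp
  rw [Finset.prod_congr rfl fun z _ => this z, prod_ctl]
  congr 2
  simp
  omega

/-- the generator of the group of determinants -/
def qq (n : ℕ) : ℂ := ω ^ 2 ^ (n - 1)

lemma qq_eight : qq n ^ 8 = 1 := by
  rw [qq, ← pow_mul, mul_comm, pow_mul, om_eight, one_pow]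

lemma star_qq_mul : star (qq n) * qq n = 1 := by
  rw [qq, star_pow, ← mul_pow, star_om_mul, one_pow]

lemma star_qq : star (qq n) = qq n ^ 7 := by
  have h1 := star_qq_mul (n := n)
  have h2 := qq_eight (n := n)
  linear_combination (-star (qq n)) * h2 + qq n ^ 7 * h1

lemma det_H : Hmat.det = ω ^ 4 := by
  rw [Hmat_eq, Matrix.det_fin_two]
  simp
  linear_combination -2 * rr_sq - om_four

lemma det_S : Smat.det = ω ^ 2 := by
  rw [Smat_eq, Matrix.det_fin_two]; simp

lemma det_T : Tmat.det = ω := by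
  rw [Tmat, Matrix.det_fin_two]; simp

lemma inC_det {M : Matrix (Fin n → Fin 2) (Fin n → Fin 2) ℂ} (h : inC M) :
    ∃ m : ℕ, M.det = qq n ^ m := by
  refine inC.induction (P := fun M => ∃ m : ℕ, M.det = qq n ^ m) ?_ ?_ ?_ ?_ h
  · intro M hM _
    rcases hM with rfl | ⟨j, rfl⟩ | ⟨j, rfl⟩ | ⟨j, rfl⟩ | ⟨k, j, hkj, rfl⟩
    · rw [Matrix.det_smul, Matrix.det_one, mul_one]
      rcases n with _ | n
      · exact ⟨1, by simp [qq]⟩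
      · refine ⟨2, ?_⟩
        rw [qq, ← pow_mul]
        simp [pow_succ]
    · refine ⟨4, ?_⟩
      rw [det_app1, det_H, qq, ← pow_mul, ← pow_mul, mul_comm]
    · refine ⟨2, ?_⟩
      rw [det_app1, det_S, qq, ← pow_mul, ← pow_mul, mul_comm]
    · refine ⟨1, ?_⟩
      rw [det_app1, det_T, qq, pow_one]
    · refine ⟨2, ?_⟩
      have hn : 2 ≤ n := by have := k.2; have := j.2; omega
      obtain ⟨m, rfl⟩ := Nat.exists_eq_add_of_le' hn
      rw [det_cnot hkj, ← om_four, qq, ← pow_mul, ← pow_mul]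
      congr 1
      simp only [Nat.add_sub_cancel, show m + 2 - 1 = m + 1 from rfl, pow_succ]
      ring
  · exact ⟨0, by simp⟩
  · rintro A B _ _ ⟨a, ha⟩ ⟨b, hb⟩
    exact ⟨a + b, by rw [Matrix.det_mul, ha, hb, pow_add]⟩
  · rintro A _ ⟨a, ha⟩
    exact ⟨7 * a, by rw [Matrix.det_conjTranspose, ha, star_pow, star_qq, pow_mul]⟩

lemma det_Dm : (Dm n).det = ω := by
  rw [Dm, ph, Matrix.det_diagonal, Finset.prod_update_of_mem (Finset.mem_univ _)]
  simp

lemma two_diag (a b : ℂ) : (!![a, 0; 0, b] : M2) = Matrix.diagonal ![a, b] := by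
  ext i j; fin_cases i <;> fin_cases j <;> simp

lemma inC_ph_qq : inC (ph (p1 n) (qq n)) := by
  match n with
  | 0 =>
    have : ph (p1 0) (qq 0) = ω • 1 := by
      ext x y
      have hx : x = p1 0 := Subsingleton.elim _ _
      have hy : y = p1 0 := Subsingleton.elim _ _
      subst hx; subst hy
      simp [ph, qq]
    rw [this]; exact inC_om
  | 1 =>
    have : ph (p1 1) (qq 1) = mux 0 (fun _ => Tmat) := by
      simp only [Tmat_diag]
      rw [mux_diag, ph]
      congr 1
      ext x
      simp only [Function.update_apply, funext_iff, Fin.forall_fin_one, p1, qq]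
      generalize x 0 = a
      fin_cases a <;> simp
    rw [this]; exact MC.T 0
  | 2 =>
    have : ph (p1 2) (qq 2) = mux 1 (fun z => if z 0 = 1 then Smat else 1) := by
      have e : (fun z : Fin 2 → Fin 2 => if z 0 = 1 then Smat else (1 : M2)) =
          fun z => Matrix.diagonal (if z 0 = 1 then ![1, ω ^ 2] else fun _ => 1) := by
        funext z; split_ifs
        · exact Smat_diag
        · exact Matrix.diagonal_one.symm
      rw [e, mux_diag, ph]
      congr 1
      ext x
      simp only [Function.update_apply, funext_iff, Fin.forall_fin_two, p1, qq]
      generalize x 0 = a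
      generalize x 1 = b
      fin_cases a <;> fin_cases b <;> simp
    rw [this]; exact MC.cs1 (by decide)
  | 3 =>
    have h1 : inC (mux (2 : Fin 3) (ctl (full 2) (p1 3) iZ)) := MC.ciZ (p1 3) 2 (full 2) (by simp)
    have h2 : inC (mux (1 : Fin 3) (fun z => (if z 0 = 1 then Smat else 1)ᴴ)) :=
      (MC.cs1 (by decide)).star
    have : ph (p1 3) (qq 3) = mux (2 : Fin 3) (ctl (full 2) (p1 3) iZ) *
        mux (1 : Fin 3) (fun z => (if z 0 = 1 then Smat else 1)ᴴ) := by
      have e1 : (ctl (full (2 : Fin 3)) (p1 3) iZ) =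
          fun z => Matrix.diagonal (if z 0 = 1 ∧ z 1 = 1 then ![ω ^ 2, -ω ^ 2] else fun _ => 1) := by
        funext z
        have e0 : (∀ k ∈ full (2 : Fin 3), z k = p1 3 k) ↔ z 0 = 1 ∧ z 1 = 1 := by
          constructor
          · intro h; exact ⟨h 0 (by simp), h 1 (by simp)⟩
          · rintro ⟨h0, h1⟩ k hk
            fin_cases k
            · exact h0
            · exact h1
            · simp at hk
        simp only [ctl, e0]
        split_ifs
        · exact two_diag _ _
        · exact Matrix.diagonal_one.symm
      have e2 : (fun z : Fin 3 → Fin 2 => (if z 0 = 1 then Smat else (1 : M2))ᴴ) =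
          fun z => Matrix.diagonal (if z 0 = 1 then ![1, -ω ^ 2] else fun _ => 1) := by
        funext z; split_ifs
        · rw [Smat_star]; exact two_diag _ _
        · simp
      rw [e1, e2, mux_diag, mux_diag, ph, Matrix.diagonal_mul_diagonal]
      congr 1
      ext x
      simp only [Function.update_apply, funext_iff, p1, qq]
      have e3 : (∀ i, x i = 1) ↔ x 0 = 1 ∧ x 1 = 1 ∧ x 2 = 1 := by
        simp [Fin.forall_fin_succ]
      simp only [e3]
      generalize x 0 = a
      generalize x 1 = b
      generalize x 2 = c
      fin_cases a <;> fin_cases b <;> fin_cases c <;> simp <;> ring_nf <;> simp [om_four]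
    rw [this]; exact h1.mul h2
  | m + 4 =>
    have : qq (m + 4) = 1 := by
      rw [qq, show m + 4 - 1 = 3 + m by omega, pow_add, pow_mul]
      norm_num [om_eight]
    rw [this, ph_one]; exact inC.one

lemma inC_iff (U : Matrix (Fin n → Fin 2) (Fin n → Fin 2) ℂ)
    (hU : U ∈ Matrix.unitaryGroup (Fin n → Fin 2) ℂ) :
    inC U ↔ (∀ i j, inDω (U i j)) ∧ ∃ m : ℕ, U.det = qq n ^ m := by
  constructor
  · intro h
    exact ⟨inC_ent h, inC_det h⟩
  · rintro ⟨h, a, ha⟩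
    obtain ⟨c, hc, k, e⟩ := synth good_gam hU h
    obtain ⟨m, hm⟩ := inC_det hc
    have hk : ω ^ k = qq n ^ (a + 7 * m) := by
      have h1 : qq n ^ a = qq n ^ m * ω ^ k := by
        rw [← ha, e, Matrix.det_mul, hm, Matrix.det_pow, det_Dm]
      have h2 : (qq n ^ m) * qq n ^ (7 * m) = 1 := by
        rw [← pow_add, show m + 7 * m = 8 * m by ring, pow_mul, qq_eight, one_pow]
      rw [pow_add, h1]
      linear_combination (-ω ^ k) * h2
    rw [e, Dm, ph_pow, hk, ← ph_pow]
    exact hc.mul (inC_ph_qq.pow _)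

lemma pow_mod8 (z : ℂ) (h : z ^ 8 = 1) (m : ℕ) : z ^ m = z ^ (m % 8) := by
  conv_lhs => rw [← Nat.div_add_mod m 8, pow_add, pow_mul, h, one_pow, one_mul]

lemma det_cond (n : ℕ) (d : ℂ) : (∃ m : ℕ, d = qq n ^ m) ↔
    (if 4 ≤ n then d = 1
         else if n = 3 then (d = 1 ∨ d = -1)
         else if n = 2 then
           (d = 1 ∨ d = -1 ∨ d = Complex.I ∨ d = -Complex.I)
         else ∃ m : ℕ, m ≤ 7 ∧ d = ω ^ m) := by
  match n with
  | 0 | 1 =>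
    simp only [qq]
    norm_num
    constructor
    · rintro ⟨m, rfl⟩
      exact ⟨m % 8, by omega, pow_mod8 _ om_eight m⟩
    · rintro ⟨m, _, rfl⟩; exact ⟨m, rfl⟩
  | 2 =>
    have e : qq 2 = Complex.I := by rw [qq, ← om_sq]; norm_num
    rw [e]
    norm_num
    constructor
    · rintro ⟨m, rfl⟩
      rw [Complex.I_pow_eq_pow_mod]
      have := Nat.mod_lt m (show 4 > 0 by norm_num)
      interval_cases m % 4 <;> simp
    · rintro (rfl | rfl | rfl | rfl)
      · exact ⟨0, by simp⟩
      · exact ⟨2, by simp⟩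
      · exact ⟨1, by simp⟩
      · exact ⟨3, by simp⟩
  | 3 =>
    have e : qq 3 = -1 := by rw [qq, ← om_four]; norm_num
    rw [e]
    norm_num
    constructor
    · rintro ⟨m, rfl⟩
      exact neg_one_pow_eq_or ℂ m
    · rintro (rfl | rfl)
      · exact ⟨0, by simp⟩
      · exact ⟨1, by simp⟩
  | m + 4 =>
    have : qq (m + 4) = 1 := by
      rw [qq, show m + 4 - 1 = 3 + m by omega, pow_add, pow_mul]
      norm_num [om_eight]
    rw [this]
    simp

end Dets

/-- Characterization of the `n`-qubit Clifford+T group with no ancillas: a unitary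
`2^n × 2^n` matrix `U` belongs to the Clifford+T group on `n` qubits iff its entries lie in
`𝔻[ω] = ℤ[1/√2, i]` and `det U = 1` (if `n ≥ 4`), `det U ∈ {−1,1}` (if `n = 3`),
`det U ∈ {i,−1,−i,1}` (if `n = 2`), and `det U` is a power of `ω` (if `n ≤ 1`). -/
theorem stmt13 (n : ℕ) (U : Matrix (Fin n → Fin 2) (Fin n → Fin 2) ℂ)
    (hU : U ∈ Matrix.unitaryGroup (Fin n → Fin 2) ℂ) :
    (∃ V ∈ CliffordT n, (V : Matrix (Fin n → Fin 2) (Fin n → Fin 2) ℂ) = U) ↔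
      ((∀ i j, inDω (U i j)) ∧
        (if 4 ≤ n then U.det = 1
         else if n = 3 then (U.det = 1 ∨ U.det = -1)
         else if n = 2 then
           (U.det = 1 ∨ U.det = -1 ∨ U.det = Complex.I ∨ U.det = -Complex.I)
         else ∃ m : ℕ, m ≤ 7 ∧ U.det = ω ^ m)) := by
  rw [← det_cond n U.det]
  exact inC_iff U hU
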